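/- Iwahori decomposition of Sp_{2m}(ℚ) at the prime 2: for every A ∈ Sp_{2m}(ℚ) there exist i₁, i₂ ∈ I, ω₁, ω₂ ∈ 𝔚 and d ∈ D₀ such that A = i₁ ω₁ d ω₂ i₂; equivalently, Sp_{2m}(ℚ) = ⋃_{ω ∈ 𝔚^{eaff}} I ω I where 𝔚^{eaff} = {ω₁ d ω₂ : d ∈ D₀, ω₁, ω₂ ∈ 𝔚}. -/

import Mathlib

open Matrix

/-- `J = [[0, I_m], [−I_m, 0]]`. -/
def Jmat (m : ℕ) (R : Type*) [CommRing R] :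
    Matrix (Fin m ⊕ Fin m) (Fin m ⊕ Fin m) R :=
  Matrix.fromBlocks 0 1 (-1) 0

/-- `Sp_{2m}(R) = {A : A J Aᵀ = J}`. -/
def SpSet (m : ℕ) (R : Type*) [CommRing R] :
    Set (Matrix (Fin m ⊕ Fin m) (Fin m ⊕ Fin m) R) :=
  {A | A * Jmat m R * Aᵀ = Jmat m R}

/-- The Weyl element `ω_s` of a permutation `s` of `{1,…,m}`: the matrix of the
map `e_i ↦ e_{s(i)}`, `e_i* ↦ e_{s(i)}*` (row vectors act on the right). -/
def permWeyl (m : ℕ) (R : Type*) [CommRing R] (s : Equiv.Perm (Fin m)) :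
    Matrix (Fin m ⊕ Fin m) (Fin m ⊕ Fin m) R :=
  Matrix.of fun p q =>
    match p, q with
    | Sum.inl i, Sum.inl j => if s i = j then 1 else 0
    | Sum.inr i, Sum.inr j => if s i = j then 1 else 0
    | _, _ => 0

/-- The Weyl element `ω_S` of a subset `S ⊆ {1,…,m}`: the matrix of the map
`e_i ↦ −e_i*`, `e_i* ↦ e_i` for `i ∈ S`, identity on the other basis vectors. -/
def signWeyl (m : ℕ) (R : Type*) [CommRing R] (S : Finset (Fin m)) :
    Matrix (Fin m ⊕ Fin m) (Fin m ⊕ Fin m) R :=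
  Matrix.of fun p q =>
    match p, q with
    | Sum.inl i, Sum.inl j => if i ∉ S ∧ i = j then 1 else 0
    | Sum.inl i, Sum.inr j => if i ∈ S ∧ i = j then -1 else 0
    | Sum.inr i, Sum.inl j => if i ∈ S ∧ i = j then 1 else 0
    | Sum.inr i, Sum.inr j => if i ∉ S ∧ i = j then 1 else 0

/-- `𝔚 = {ω_s ω_S}`, a set of representatives for the Weyl group. -/
def WeylSet (m : ℕ) (R : Type*) [CommRing R] :
    Set (Matrix (Fin m ⊕ Fin m) (Fin m ⊕ Fin m) R) :=
  {W | ∃ (s : Equiv.Perm (Fin m)) (S : Finset (Fin m)),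
      W = permWeyl m R s * signWeyl m R S}

/-- `B(𝔽₂) = {[[α, αβ], [0, (αᵀ)⁻¹]]}` with `α` unipotent upper triangular and
`β` symmetric, over `𝔽₂ = ZMod 2`. -/
def BOverF2 (m : ℕ) : Set (Matrix (Fin m ⊕ Fin m) (Fin m ⊕ Fin m) (ZMod 2)) :=
  {A | ∃ α β : Matrix (Fin m) (Fin m) (ZMod 2),
      (∀ i j : Fin m, j < i → α i j = 0) ∧ (∀ i, α i i = 1) ∧ βᵀ = β ∧
      A = Matrix.fromBlocks α (α * β) 0 (αᵀ)⁻¹}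

/-- The Iwahori subgroup `I = red₂⁻¹(B(𝔽₂)) ⊆ Sp_{2m}(ℤ)` at the prime 2. -/
def IwahoriSet (m : ℕ) : Set (Matrix (Fin m ⊕ Fin m) (Fin m ⊕ Fin m) ℤ) :=
  {A | A ∈ SpSet m ℤ ∧ A.map (Int.cast : ℤ → ZMod 2) ∈ BOverF2 m}

/-- `D₀ = {diag(d₁,…,d_m, d₁⁻¹,…,d_m⁻¹) : dᵢ ∈ ℤ_{>0}, d_m | d_{m−1} | ⋯ | d₁}`. -/
def D0Set (m : ℕ) : Set (Matrix (Fin m ⊕ Fin m) (Fin m ⊕ Fin m) ℚ) :=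
  {A | ∃ d : Fin m → ℤ, (∀ i, 0 < d i) ∧ (∀ i j : Fin m, i ≤ j → d j ∣ d i) ∧
      A = Matrix.diagonal (Sum.elim (fun i => (d i : ℚ)) fun i => ((d i : ℚ))⁻¹)}

/-- `N`: integral matrices `[[α, αβ], [0, (αᵀ)⁻¹]]` with `α` unipotent upper
triangular and `β` symmetric. -/
def NSet (m : ℕ) : Set (Matrix (Fin m ⊕ Fin m) (Fin m ⊕ Fin m) ℤ) :=
  {A | ∃ α β : Matrix (Fin m) (Fin m) ℤ,
      (∀ i j : Fin m, j < i → α i j = 0) ∧ (∀ i, α i i = 1) ∧ βᵀ = β ∧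
      A = Matrix.fromBlocks α (α * β) 0 (αᵀ)⁻¹}

/-- `D = {ω⁻¹ d ω : d ∈ D₀, ω ∈ 𝔚}`. -/
def DSet (m : ℕ) : Set (Matrix (Fin m ⊕ Fin m) (Fin m ⊕ Fin m) ℚ) :=
  {A | ∃ d ∈ D0Set m, ∃ w ∈ WeylSet m ℚ, A = w⁻¹ * d * w}

/-- Entrywise cast of an integral matrix to a rational one. -/
def castQ (m : ℕ) (A : Matrix (Fin m ⊕ Fin m) (Fin m ⊕ Fin m) ℤ) :
    Matrix (Fin m ⊕ Fin m) (Fin m ⊕ Fin m) ℚ :=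
  A.map (Int.cast : ℤ → ℚ)

section

variable {l : Type*}

/-- The sign `J p p.swap`, where `J` is Mathlib's standard symplectic matrix. -/
def sympSign : l ⊕ l → ℤ := Sum.elim (fun _ => -1) fun _ => 1

lemma sympSign_swap (p : l ⊕ l) : sympSign p.swap = -sympSign p := by
  cases p <;> simp [sympSign]

lemma sympSign_mul_self (p : l ⊕ l) : sympSign p * sympSign p = 1 := by
  cases p <;> simp [sympSign]

variable [DecidableEq l]

lemma J_apply (R : Type*) [CommRing R] (p q : l ⊕ l) :
    J l R p q = if q = p.swap then (sympSign p : R) else 0 := by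
  cases p <;> cases q <;> simp [J, sympSign, Matrix.one_apply, eq_comm, Matrix.neg_apply]
  split_ifs <;> simp

/-- The symmetric matrix `S` for which `1 + S * J` is the element of the unipotent radical of
the stabiliser of `e_p*` whose `p`-th column is `e_p + w`. -/
def radicalSym (p : l ⊕ l) (w : l ⊕ l → ℤ) : Matrix (l ⊕ l) (l ⊕ l) ℤ :=
  (-sympSign p) • (vecMulVec (Pi.single p.swap 1) w + vecMulVec w (Pi.single p.swap 1)
    - w p.swap • vecMulVec (Pi.single p.swap 1) (Pi.single p.swap 1))

lemma radicalSym_transpose (p : l ⊕ l) (w : l ⊕ l → ℤ) :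
    (radicalSym p w)ᵀ = radicalSym p w := by
  simp only [radicalSym, transpose_smul, transpose_sub, transpose_add, transpose_vecMulVec]
  rw [add_comm (vecMulVec w _)]

lemma radicalSym_neg (p : l ⊕ l) (w : l ⊕ l → ℤ) :
    radicalSym p (-w) = -radicalSym p w := by
  simp only [radicalSym, Matrix.vecMulVec_neg, Matrix.neg_vecMulVec, Pi.neg_apply, neg_smul,
    ← smul_neg]
  congr 1
  rw [smul_neg]
  abel

/-- Integral matrices that are upper triangular modulo `2` with respect to the order `ρ`, and
agree with the identity outside `P × P`. -/
def IsIwahoriOn (ρ : l ⊕ l → ℤ) (P : Finset (l ⊕ l)) (A : Matrix (l ⊕ l) (l ⊕ l) ℤ) : Prop :=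
  (∀ r s, ρ s < ρ r → 2 ∣ A r s) ∧
    ∀ r s, (r ∉ P ∨ s ∉ P) → A r s = (1 : Matrix (l ⊕ l) (l ⊕ l) ℤ) r s

lemma IsIwahoriOn.one (ρ : l ⊕ l → ℤ) (P : Finset (l ⊕ l)) : IsIwahoriOn ρ P 1 :=
  ⟨fun r s h => by rw [Matrix.one_apply_ne (by rintro rfl; omega)]; simp, fun _ _ _ => rfl⟩

lemma IsIwahoriOn.transpose {ρ : l ⊕ l → ℤ} {P : Finset (l ⊕ l)}
    {A : Matrix (l ⊕ l) (l ⊕ l) ℤ} (hA : IsIwahoriOn (-ρ) P A) : IsIwahoriOn ρ P Aᵀ :=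
  ⟨fun r s h => hA.1 s r (by simpa using h), fun r s h => by
    rw [transpose_apply, hA.2 s r h.symm, ← transpose_apply (M := 1), transpose_one]⟩

lemma IsIwahoriOn.mono {ρ : l ⊕ l → ℤ} {P P' : Finset (l ⊕ l)} (h : P' ⊆ P)
    {A : Matrix (l ⊕ l) (l ⊕ l) ℤ} (hA : IsIwahoriOn ρ P' A) : IsIwahoriOn ρ P A :=
  ⟨hA.1, fun r s hrs => hA.2 r s (hrs.imp (fun h' => mt (@h _) h') fun h' => mt (@h _) h')⟩

variable [Fintype l]

lemma mul_J_apply {R : Type*} [CommRing R] (A : Matrix (l ⊕ l) (l ⊕ l) R) (p q : l ⊕ l) :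
    (A * J l R) p q = A p q.swap * (sympSign q.swap : R) := by
  rw [Matrix.mul_apply, Finset.sum_eq_single q.swap]
  · simp [J_apply]
  · intro k _ hk
    rw [J_apply, if_neg, mul_zero]
    rintro rfl
    simp at hk
  · simp

lemma dotProduct_J_mulVec_comm (v w : l ⊕ l → ℤ) :
    v ⬝ᵥ (J l ℤ *ᵥ w) = -(w ⬝ᵥ (J l ℤ *ᵥ v)) := by
  rw [Matrix.dotProduct_mulVec, ← Matrix.mulVec_transpose, J_transpose, Matrix.neg_mulVec,
    neg_dotProduct, dotProduct_comm]

lemma dotProduct_J_mulVec_self (w : l ⊕ l → ℤ) : w ⬝ᵥ (J l ℤ *ᵥ w) = 0 := by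
  have := dotProduct_J_mulVec_comm w w
  omega

lemma single_dotProduct_J_mulVec (p : l ⊕ l) (w : l ⊕ l → ℤ) :
    Pi.single p 1 ⬝ᵥ (J l ℤ *ᵥ w) = sympSign p * w p.swap := by
  rw [single_dotProduct, one_mul, Matrix.mulVec, dotProduct, Finset.sum_eq_single p.swap]
  · simp [J_apply]
  · intro k _ hk
    simp [J_apply, hk]
  · simp

lemma radicalSym_mul_J_mul (p : l ⊕ l) (w : l ⊕ l → ℤ) (hw : w p = 0) :
    radicalSym p w * J l ℤ * radicalSym p w = 0 := by
  have key (a b c d : l ⊕ l → ℤ) (h : b ⬝ᵥ (J l ℤ *ᵥ c) = 0) :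
      vecMulVec a b * J l ℤ * vecMulVec c d = 0 := by
    rw [Matrix.mul_assoc, Matrix.mul_vecMulVec, Matrix.vecMulVec_mul_vecMulVec, h]
    simp
  have h1 : Pi.single p.swap 1 ⬝ᵥ (J l ℤ *ᵥ w) = 0 := by
    rw [single_dotProduct_J_mulVec, Sum.swap_swap, hw, mul_zero]
  have h2 : w ⬝ᵥ (J l ℤ *ᵥ Pi.single p.swap 1) = 0 := by
    rw [dotProduct_J_mulVec_comm, h1, neg_zero]
  simp [-zsmul_eq_mul, radicalSym, add_mul, sub_mul, mul_add, mul_sub, key _ _ _ _ h1,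
    key _ _ _ _ h2,
    key _ _ _ _ (dotProduct_J_mulVec_self _)]

/-- The radical element with `p`-th column `e_p + w`. -/
def radicalMat (p : l ⊕ l) (w : l ⊕ l → ℤ) : Matrix (l ⊕ l) (l ⊕ l) ℤ :=
  1 + radicalSym p w * J l ℤ

lemma radicalMat_apply (p : l ⊕ l) (w : l ⊕ l → ℤ) (r s : l ⊕ l) :
    radicalMat p w r s = (1 : Matrix (l ⊕ l) (l ⊕ l) ℤ) r s +
      (if s = p then w r else if r = p.swap then -sympSign p * sympSign s.swap * w s.swap
        else 0) := by
  rw [radicalMat, Matrix.add_apply, mul_J_apply]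
  congr 1
  have h : s.swap = p.swap ↔ s = p := (Equiv.sumComm l l).injective.eq_iff
  have h3 := sympSign_mul_self p
  simp only [radicalSym, Matrix.smul_apply, Matrix.sub_apply, Matrix.add_apply, vecMulVec_apply,
    Pi.single_apply,
    smul_eq_mul, Int.cast_id, h]
  by_cases hs : s = p
  · subst hs
    rw [sympSign_swap]
    by_cases hr : r = s.swap
    · subst hr
      simp
      linear_combination (w s.swap) * h3
    · simp [hr]
      linear_combination (w r) * h3
  · by_cases hr : r = p.swap <;> simp [hs, hr]
    ring

lemma radicalMat_mem (p : l ⊕ l) (w : l ⊕ l → ℤ) (hw : w p = 0) :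
    radicalMat p w ∈ symplecticGroup l ℤ := by
  rw [SymplecticGroup.mem_iff, radicalMat]
  have h0 := radicalSym_mul_J_mul p w hw
  have hJ := J_squared l ℤ
  rw [transpose_add, transpose_mul, radicalSym_transpose, J_transpose, transpose_one]
  set S := radicalSym p w
  set j := J l ℤ
  calc (1 + S * j) * j * (1 + -j * S)
      = j + S * (j * j) - (j * j) * S - S * (j * j) * j * S := by noncomm_ring
    _ = j + S * j * S := by rw [hJ]; noncomm_ring
    _ = j := by rw [h0, add_zero]

lemma radicalMat_mul_neg (p : l ⊕ l) (w : l ⊕ l → ℤ) (hw : w p = 0) :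
    radicalMat p w * radicalMat p (-w) = 1 := by
  rw [radicalMat, radicalMat, radicalSym_neg]
  have h0 := radicalSym_mul_J_mul p w hw
  set S := radicalSym p w
  set j := J l ℤ
  calc (1 + S * j) * (1 + -S * j) = 1 - (S * j * S) * j := by noncomm_ring
    _ = 1 := by rw [h0]; simp

lemma IsIwahoriOn.mul {ρ : l ⊕ l → ℤ} {P : Finset (l ⊕ l)} {A B : Matrix (l ⊕ l) (l ⊕ l) ℤ}
    (hA : IsIwahoriOn ρ P A) (hB : IsIwahoriOn ρ P B) : IsIwahoriOn ρ P (A * B) := by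
  refine ⟨fun r s h => ?_, fun r s h => ?_⟩
  · rw [Matrix.mul_apply]
    refine Finset.dvd_sum fun k _ => ?_
    by_cases hk : ρ k < ρ r
    · exact (hA.1 r k hk).mul_right _
    · exact (hB.1 k s (by omega)).mul_left _
  · rw [Matrix.mul_apply]
    rcases h with h | h
    · simp_rw [hA.2 r _ (Or.inl h), ← Matrix.mul_apply, one_mul, hB.2 r s (Or.inl h)]
    · simp_rw [hB.2 _ s (Or.inr h), ← Matrix.mul_apply, mul_one, hA.2 r s (Or.inr h)]

/-- The Iwahori subgroup for the order `ρ`, acting only on the coordinates in `P`. -/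
def iwahoriOn (ρ : l ⊕ l → ℤ) (P : Finset (l ⊕ l)) : Subgroup (symplecticGroup l ℤ) where
  carrier := {g | IsIwahoriOn ρ P g ∧ IsIwahoriOn ρ P (g⁻¹ : symplecticGroup l ℤ)}
  mul_mem' {a b} ha hb := ⟨ha.1.mul hb.1, by rw [_root_.mul_inv_rev]; exact hb.2.mul ha.2⟩
  one_mem' := ⟨.one ρ P, by rw [inv_one]; exact .one ρ P⟩
  inv_mem' {a} ha := ⟨ha.2, by rw [inv_inv]; exact ha.1⟩

lemma iwahoriOn_mono (ρ : l ⊕ l → ℤ) {P P' : Finset (l ⊕ l)} (h : P' ⊆ P) :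
    iwahoriOn ρ P' ≤ iwahoriOn ρ P := fun _ hg => ⟨hg.1.mono h, hg.2.mono h⟩

lemma exists_iwahoriOn_transpose {ρ : l ⊕ l → ℤ} {P : Finset (l ⊕ l)}
    {g : symplecticGroup l ℤ} (hg : g ∈ iwahoriOn (-ρ) P) :
    ∃ h ∈ iwahoriOn ρ P, (h : Matrix (l ⊕ l) (l ⊕ l) ℤ) = (g : Matrix _ _ ℤ)ᵀ := by
  have hinv : (⟨_, SymplecticGroup.transpose_mem g.2⟩ : symplecticGroup l ℤ)⁻¹ =
      ⟨((g⁻¹ : symplecticGroup l ℤ) : Matrix (l ⊕ l) (l ⊕ l) ℤ)ᵀ,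
        SymplecticGroup.transpose_mem (SetLike.coe_mem _)⟩ := by
    rw [inv_eq_iff_mul_eq_one]
    ext1
    change (g : Matrix (l ⊕ l) (l ⊕ l) ℤ)ᵀ *
      ((g⁻¹ : symplecticGroup l ℤ) : Matrix (l ⊕ l) (l ⊕ l) ℤ)ᵀ = 1
    rw [← transpose_mul, ← Submonoid.coe_mul, inv_mul_cancel, Submonoid.coe_one, transpose_one]
  refine ⟨⟨_, SymplecticGroup.transpose_mem g.2⟩, ⟨hg.1.transpose, ?_⟩, rfl⟩
  rw [hinv]
  exact hg.2.transpose

lemma isIwahoriOn_radicalMat {ρ : l ⊕ l → ℤ} (hρ : ∀ p, ρ p.swap = -ρ p) {P : Finset (l ⊕ l)}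
    (hP : ∀ p ∈ P, p.swap ∈ P) {p : l ⊕ l} (hp : p ∈ P) {w : l ⊕ l → ℤ}
    (hwP : ∀ r ∉ P, w r = 0) (hw : ∀ r, ρ p < ρ r → 2 ∣ w r) :
    IsIwahoriOn ρ P (radicalMat p w) := by
  refine ⟨fun r s h => ?_, fun r s h => ?_⟩
  · rw [radicalMat_apply, Matrix.one_apply_ne (by rintro rfl; omega), zero_add]
    split_ifs with h1 h2
    · subst h1; exact hw r h
    · subst h2
      refine (hw _ ?_).mul_left _
      rw [hρ] at h ⊢
      omega
    · simp
  · rw [radicalMat_apply]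
    split_ifs with h1 h2
    · subst h1
      rw [hwP r (by tauto), add_zero]
    · subst h2
      rw [hwP s.swap, mul_zero, add_zero]
      intro hs
      have := hP _ hs
      rw [Sum.swap_swap] at this
      have := hP _ hp
      tauto
    · simp

lemma exists_iwahoriOn_radical {ρ : l ⊕ l → ℤ} (hρ : ∀ p, ρ p.swap = -ρ p)
    {P : Finset (l ⊕ l)} (hP : ∀ p ∈ P, p.swap ∈ P) {p : l ⊕ l} (hp : p ∈ P) {w : l ⊕ l → ℤ}
    (hwp : w p = 0) (hwP : ∀ r ∉ P, w r = 0) (hw : ∀ r, ρ p < ρ r → 2 ∣ w r) :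
    ∃ g ∈ iwahoriOn ρ P, (g : Matrix (l ⊕ l) (l ⊕ l) ℤ) = radicalMat p w := by
  have hinv : (⟨_, radicalMat_mem p w hwp⟩ : symplecticGroup l ℤ)⁻¹ =
      ⟨_, radicalMat_mem p (-w) (by simp [hwp])⟩ := by
    rw [inv_eq_iff_mul_eq_one]
    ext1
    exact radicalMat_mul_neg p w hwp
  refine ⟨⟨_, radicalMat_mem p w hwp⟩, ⟨isIwahoriOn_radicalMat hρ hP hp hwP hw, ?_⟩, rfl⟩
  rw [hinv]
  exact isIwahoriOn_radicalMat hρ hP hp (by simpa using hwP) (by simpa using hw)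

end

section

variable {l : Type*}

lemma neg_order_swap {ρ : l ⊕ l → ℤ} (hρ : ∀ p, ρ p.swap = -ρ p) (p : l ⊕ l) :
    (-ρ) p.swap = -(-ρ) p := by
  simp [hρ]

variable [Fintype l] [DecidableEq l]

lemma exists_iwahoriOn_row_op {ρ : l ⊕ l → ℤ} (hρ : ∀ p, ρ p.swap = -ρ p)
    {P : Finset (l ⊕ l)} (hP : ∀ p ∈ P, p.swap ∈ P) {p p' : l ⊕ l} (hp : p ∈ P) (hp' : p' ∈ P)
    (hne : p' ≠ p) (k : ℤ) :
    ∃ g ∈ iwahoriOn ρ P, ∀ M : Matrix (l ⊕ l) (l ⊕ l) ℤ,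
      (∀ s, ((g : Matrix (l ⊕ l) (l ⊕ l) ℤ) * M) p' s = M p' s + 2 * k * M p s) ∧
      ∀ s, ((g : Matrix (l ⊕ l) (l ⊕ l) ℤ) * M) p s = M p s := by
  obtain ⟨g, hg, hgw⟩ := exists_iwahoriOn_radical hρ hP hp (w := Pi.single p' (2 * k))
    (Pi.single_eq_of_ne' hne _)
    (fun r hr => Pi.single_eq_of_ne (by rintro rfl; exact hr hp') _)
    (fun r _ => by
      rw [Pi.single_apply]
      split_ifs
      · exact dvd_mul_right _ _
      · simp)
  have hpp : p ≠ p.swap := by cases p <;> simp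
  have h1 (s : l ⊕ l) : radicalMat p (Pi.single p' (2 * k)) p' s =
      (1 : Matrix (l ⊕ l) (l ⊕ l) ℤ) p' s + 2 * k * (1 : Matrix (l ⊕ l) (l ⊕ l) ℤ) p s := by
    rw [radicalMat_apply]
    congr 1
    by_cases hs : s = p
    · rw [hs, if_pos rfl, Pi.single_eq_same, Matrix.one_apply_eq, mul_one]
    · rw [if_neg hs, Matrix.one_apply_ne (Ne.symm hs), mul_zero]
      split_ifs with h
      · rw [Pi.single_eq_of_ne, mul_zero]
        intro h'
        rw [h] at h'
        exact hs ((Equiv.sumComm l l).injective h')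
      · rfl
  have h2 (s : l ⊕ l) : radicalMat p (Pi.single p' (2 * k)) p s =
      (1 : Matrix (l ⊕ l) (l ⊕ l) ℤ) p s := by
    rw [radicalMat_apply, if_neg hpp, Pi.single_eq_of_ne' hne]
    simp
  refine ⟨g, hg, fun M => ⟨fun s => ?_, fun s => ?_⟩⟩
  · rw [hgw, Matrix.mul_apply]
    simp_rw [h1, add_mul, Finset.sum_add_distrib, mul_assoc, ← Finset.mul_sum,
      ← Matrix.mul_apply, one_mul]
  · rw [hgw, Matrix.mul_apply]
    simp_rw [h2, ← Matrix.mul_apply, one_mul]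

lemma exists_iwahoriOn_col_op {ρ : l ⊕ l → ℤ} (hρ : ∀ p, ρ p.swap = -ρ p)
    {Q : Finset (l ⊕ l)} (hQ : ∀ q ∈ Q, q.swap ∈ Q) {q q' : l ⊕ l} (hq : q ∈ Q) (hq' : q' ∈ Q)
    (hne : q' ≠ q) (k : ℤ) :
    ∃ h ∈ iwahoriOn ρ Q, ∀ M : Matrix (l ⊕ l) (l ⊕ l) ℤ,
      (∀ r, (M * (h : Matrix (l ⊕ l) (l ⊕ l) ℤ)) r q' = M r q' + 2 * k * M r q) ∧
      ∀ r, (M * (h : Matrix (l ⊕ l) (l ⊕ l) ℤ)) r q = M r q := by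
  obtain ⟨g, hg, hgM⟩ := exists_iwahoriOn_row_op (neg_order_swap hρ) hQ hq hq' hne k
  obtain ⟨h, hh, hhg⟩ := exists_iwahoriOn_transpose hg
  refine ⟨h, hh, fun M => ?_⟩
  have hM : M * (h : Matrix (l ⊕ l) (l ⊕ l) ℤ) = (g.1 * Mᵀ)ᵀ := by simp [hhg]
  rw [hM]
  exact hgM Mᵀ

lemma iwahoriOn_mul_mul_support {ρ : l ⊕ l → ℤ} {P Q : Finset (l ⊕ l)}
    {M : Matrix (l ⊕ l) (l ⊕ l) ℤ} (hM : ∀ r s, (r ∉ P ∨ s ∉ Q) → M r s = 0)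
    {g h : symplecticGroup l ℤ} (hg : g ∈ iwahoriOn ρ P) (hh : h ∈ iwahoriOn ρ Q) (r s : l ⊕ l)
    (hrs : r ∉ P ∨ s ∉ Q) : ((g : Matrix (l ⊕ l) (l ⊕ l) ℤ) * M * h) r s = 0 := by
  rcases hrs with hr | hs
  · rw [Matrix.mul_assoc, Matrix.mul_apply]
    simp_rw [hg.1.2 r _ (Or.inl hr), ← Matrix.mul_apply, one_mul, Matrix.mul_apply,
      hM r _ (Or.inl hr), zero_mul, Finset.sum_const_zero]
  · rw [Matrix.mul_apply]
    simp_rw [hh.1.2 _ s (Or.inr hs), ← Matrix.mul_apply, mul_one, Matrix.mul_apply,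
      hM _ s (Or.inr hs), mul_zero, Finset.sum_const_zero]

lemma exists_abs_add_two_mul_le (x : ℤ) {y : ℤ} (hy : y ≠ 0) :
    ∃ k, |x + 2 * k * y| ≤ |y| := by
  have h2 : 0 < 2 * |y| := by positivity
  have h1 := Int.emod_nonneg (x + |y|) h2.ne'
  have h3 := Int.emod_lt_of_pos (x + |y|) h2
  have h4 := Int.emod_add_mul_ediv (x + |y|) (2 * |y|)
  refine ⟨-((x + |y|) / (2 * |y|)) * y.sign, ?_⟩
  have h5 : y.sign * y = |y| := Int.sign_mul_self_eq_abs y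
  have h6 : x + 2 * (-((x + |y|) / (2 * |y|)) * y.sign) * y =
      (x + |y|) % (2 * |y|) - |y| := by
    linear_combination (-2 * ((x + |y|) / (2 * |y|))) * h5 - h4
  rw [h6, abs_le]
  constructor <;> linarith

/-- The entry at `(p, q)` is odd, of least absolute value among the odd entries of all matrices
in the double coset of `M`. -/
def IsAbsMinimal (ρ : l ⊕ l → ℤ) (P Q : Finset (l ⊕ l)) (M : Matrix (l ⊕ l) (l ⊕ l) ℤ)
    (p q : l ⊕ l) : Prop :=
  Odd (M p q) ∧ ∀ g ∈ iwahoriOn ρ P, ∀ h ∈ iwahoriOn ρ Q, ∀ p' q',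
    Odd (((g : Matrix (l ⊕ l) (l ⊕ l) ℤ) * M * h) p' q') →
      |M p q| ≤ |((g : Matrix (l ⊕ l) (l ⊕ l) ℤ) * M * h) p' q'|

namespace IsAbsMinimal

variable {ρ : l ⊕ l → ℤ} {P Q : Finset (l ⊕ l)} {M : Matrix (l ⊕ l) (l ⊕ l) ℤ} {p q : l ⊕ l}

lemma ne_zero (hmin : IsAbsMinimal ρ P Q M p q) : M p q ≠ 0 := by
  intro h
  have := hmin.1
  rw [h] at this
  exact absurd this (by decide)

lemma transpose (hmin : IsAbsMinimal ρ P Q M p q) : IsAbsMinimal (-ρ) Q P Mᵀ q p := by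
  refine ⟨hmin.1, fun g hg h hh p' q' hodd => ?_⟩
  obtain ⟨g', hg', hgg⟩ := exists_iwahoriOn_transpose hg
  obtain ⟨h', hh', hhh⟩ := exists_iwahoriOn_transpose hh
  have key : (g : Matrix (l ⊕ l) (l ⊕ l) ℤ) * Mᵀ * h.1 =
      ((h' : Matrix (l ⊕ l) (l ⊕ l) ℤ) * M * g'.1)ᵀ := by
    simp [hgg, hhh, Matrix.mul_assoc]
  rw [key] at hodd ⊢
  exact hmin.2 h' hh' g' hg' q' p' hodd

lemma mul_left (hmin : IsAbsMinimal ρ P Q M p q) {g : symplecticGroup l ℤ}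
    (hg : g ∈ iwahoriOn ρ P) {p' : l ⊕ l}
    (h : |((g : Matrix (l ⊕ l) (l ⊕ l) ℤ) * M) p' q| = |M p q|) :
    IsAbsMinimal ρ P Q ((g : Matrix (l ⊕ l) (l ⊕ l) ℤ) * M) p' q := by
  refine ⟨by rw [← odd_abs, h, odd_abs]; exact hmin.1, fun g' hg' h' hh' r s hodd => ?_⟩
  have := hmin.2 (g' * g) (mul_mem hg' hg) h' hh' r s
  rw [Submonoid.coe_mul, Matrix.mul_assoc (g' : Matrix (l ⊕ l) (l ⊕ l) ℤ)] at this
  rw [h]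
  exact this hodd

lemma mul_right (hmin : IsAbsMinimal ρ P Q M p q) {h : symplecticGroup l ℤ}
    (hh : h ∈ iwahoriOn ρ Q) {q' : l ⊕ l}
    (habs : |(M * (h : Matrix (l ⊕ l) (l ⊕ l) ℤ)) p q'| = |M p q|) :
    IsAbsMinimal ρ P Q (M * (h : Matrix (l ⊕ l) (l ⊕ l) ℤ)) p q' := by
  refine ⟨by rw [← odd_abs, habs, odd_abs]; exact hmin.1, fun g' hg' h' hh' r s hodd => ?_⟩
  have := hmin.2 g' hg' (h * h') (mul_mem hh hh') r s
  rw [Submonoid.coe_mul, ← Matrix.mul_assoc, Matrix.mul_assoc _ M] at this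
  rw [habs]
  exact this hodd

lemma mem (hmin : IsAbsMinimal ρ P Q M p q) (hM : ∀ r s, (r ∉ P ∨ s ∉ Q) → M r s = 0) :
    p ∈ P ∧ q ∈ Q := by
  by_contra h
  exact hmin.ne_zero (hM p q (by tauto))

lemma dvd_row (hρ : ∀ p, ρ p.swap = -ρ p) (hQ : ∀ q ∈ Q, q.swap ∈ Q)
    (hM : ∀ r s, (r ∉ P ∨ s ∉ Q) → M r s = 0) (hmin : IsAbsMinimal ρ P Q M p q) (q' : l ⊕ l) :
    M p q ∣ M p q' := by
  by_cases hq' : q' ∈ Q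
  swap
  · rw [hM p q' (Or.inr hq')]
    exact dvd_zero _
  by_cases hne : q' = q
  · rw [hne]
  obtain ⟨hp, hq⟩ := hmin.mem hM
  obtain ⟨k, hk⟩ := exists_abs_add_two_mul_le (M p q') hmin.ne_zero
  obtain ⟨h, hh, hhM⟩ := exists_iwahoriOn_col_op hρ hQ hq hq' hne k
  have e1 := (hhM M).1 p
  have e2 := (hhM M).2 p
  have hmin' := hmin.mul_right hh (q' := q) (by rw [e2])
  set N := M * (h : Matrix (l ⊕ l) (l ⊕ l) ℤ) with hN
  rw [← e1] at hk
  suffices hd : M p q ∣ N p q' by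
    rw [e1] at hd
    exact (dvd_add_left (Dvd.intro_left _ rfl)).1 hd
  rcases Int.even_or_odd (N p q') with hev | hodd
  · by_contra hnd
    have h0 : N p q' ≠ 0 := by
      intro h0
      rw [h0] at hnd
      exact hnd (dvd_zero _)
    have hlt : |N p q'| < |M p q| := by
      refine lt_of_le_of_ne hk fun he => ?_
      have := hmin.1
      rw [← odd_abs, ← he, odd_abs] at this
      exact (Int.not_odd_iff_even.2 hev) this
    obtain ⟨k', hk'⟩ := exists_abs_add_two_mul_le (N p q) h0
    obtain ⟨h', hh', hhN⟩ := exists_iwahoriOn_col_op hρ hQ hq' hq (Ne.symm hne) k'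
    have e3 := (hhN N).1 p
    have := hmin'.2 1 (one_mem _) h' hh' p q
    rw [Submonoid.coe_one, one_mul, e3] at this
    have h5 := this (by
      rw [e2]
      exact hmin.1.add_even ((even_two_mul _).mul_right _))
    rw [e2] at h5 hk'
    omega
  · have := hmin.2 1 (one_mem _) h hh p q'
    rw [Submonoid.coe_one, one_mul] at this
    have h3 := le_antisymm hk (this hodd)
    exact (abs_dvd_abs _ _).1 (by rw [h3])

lemma dvd_col (hρ : ∀ p, ρ p.swap = -ρ p) (hP : ∀ p ∈ P, p.swap ∈ P)
    (hM : ∀ r s, (r ∉ P ∨ s ∉ Q) → M r s = 0) (hmin : IsAbsMinimal ρ P Q M p q) (p' : l ⊕ l) :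
    M p q ∣ M p' q :=
  hmin.transpose.dvd_row (neg_order_swap hρ) hP (fun r s h => hM s r h.symm) p'

lemma dvd (hρ : ∀ p, ρ p.swap = -ρ p) (hP : ∀ p ∈ P, p.swap ∈ P) (hQ : ∀ q ∈ Q, q.swap ∈ Q)
    (hM : ∀ r s, (r ∉ P ∨ s ∉ Q) → M r s = 0) (hmin : IsAbsMinimal ρ P Q M p q) (p' q' : l ⊕ l) :
    M p q ∣ M p' q' := by
  by_cases hp' : p' ∈ P
  swap
  · rw [hM p' q' (Or.inl hp')]
    exact dvd_zero _
  by_cases hne : p' = p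
  · rw [hne]
    exact hmin.dvd_row hρ hQ hM q'
  obtain ⟨hp, hq⟩ := hmin.mem hM
  obtain ⟨k, hk⟩ := exists_abs_add_two_mul_le (M p' q) hmin.ne_zero
  obtain ⟨g, hg, hgM⟩ := exists_iwahoriOn_row_op hρ hP hp hp' hne k
  have e1 := (hgM M).1
  have e2 := (hgM M).2
  have hmin1 := hmin.mul_left hg (p' := p) (by rw [e2])
  have hM1 := iwahoriOn_mul_mul_support hM hg (one_mem (iwahoriOn ρ Q))
  rw [Submonoid.coe_one, mul_one] at hM1
  set N := (g : Matrix (l ⊕ l) (l ⊕ l) ℤ) * M with hN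
  rw [← e1] at hk
  obtain ⟨c, hc⟩ := hmin1.dvd_col hρ hP hM1 p'
  have hne0 := hmin.ne_zero
  rw [e2] at hc
  have hc1 : |c| ≤ 1 := by
    rw [hc, abs_mul] at hk
    exact le_of_mul_le_mul_left (by rwa [mul_one]) (abs_pos.2 hne0)
  obtain ⟨u, hu, huc⟩ : ∃ u : ℤ, |u| = 1 ∧ |1 + 2 * u * c| = 1 := by
    rw [abs_le] at hc1
    obtain rfl | rfl | rfl : c = -1 ∨ c = 0 ∨ c = 1 := by omega
    exacts [⟨1, by norm_num⟩, ⟨1, by norm_num⟩, ⟨-1, by norm_num⟩]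
  obtain ⟨g', hg', hgN⟩ := exists_iwahoriOn_row_op hρ hP hp' hp (Ne.symm hne) u
  have e3 := (hgN N).1
  have hval : ((g' : Matrix (l ⊕ l) (l ⊕ l) ℤ) * N) p q = M p q * (1 + 2 * u * c) := by
    rw [e3, e2, hc]
    ring
  have habs : |((g' : Matrix (l ⊕ l) (l ⊕ l) ℤ) * N) p q| = |M p q| := by
    rw [hval, abs_mul, huc, mul_one]
  have hmin2 := hmin1.mul_left hg' (p' := p) (by rw [habs, e2])
  have hM2 := iwahoriOn_mul_mul_support hM1 hg' (one_mem (iwahoriOn ρ Q))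
  rw [Submonoid.coe_one, mul_one] at hM2
  have hd := hmin2.dvd_row hρ hQ hM2 q'
  rw [← abs_dvd, habs, abs_dvd, e3, e2] at hd
  have hd1 := hmin.dvd_row hρ hQ hM q'
  have hd2 : M p q ∣ 2 * (u * N p' q') := by
    rw [← mul_assoc]
    exact (dvd_add_right hd1).1 hd
  have hcop : IsCoprime (M p q) 2 := by
    obtain ⟨z, hz⟩ := hmin.1
    exact ⟨1, -z, by rw [hz]; ring⟩
  have hd3 := hcop.dvd_of_dvd_mul_left hd2
  have hd4 : M p q ∣ N p' q' := by
    rwa [← dvd_abs, abs_mul, hu, one_mul, dvd_abs] at hd3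
  rw [e1] at hd4
  exact (dvd_add_left (hd1.mul_left _)).1 hd4

end IsAbsMinimal

end

lemma dvd_mul_mul_apply {n : Type*} [Fintype n] {a : ℤ} {A M B : Matrix n n ℤ}
    (h : ∀ r s, a ∣ M r s) (r s : n) : a ∣ (A * M * B) r s := by
  rw [Matrix.mul_apply]
  refine Finset.dvd_sum fun k _ => Dvd.dvd.mul_right ?_ _
  rw [Matrix.mul_apply]
  exact Finset.dvd_sum fun j _ => (h j k).mul_left _

section

variable {l : Type*} [Fintype l] [DecidableEq l] {ρ : l ⊕ l → ℤ} {P Q : Finset (l ⊕ l)}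
  {M : Matrix (l ⊕ l) (l ⊕ l) ℤ} {p q : l ⊕ l}

lemma IsAbsMinimal.exists_move_col (hρ : ∀ p, ρ p.swap = -ρ p) (hQ : ∀ q ∈ Q, q.swap ∈ Q)
    (hM : ∀ r s, (r ∉ P ∨ s ∉ Q) → M r s = 0) (hmin : IsAbsMinimal ρ P Q M p q) {q' : l ⊕ l}
    (hodd : Odd (M p q')) (hne : q' ≠ q) :
    ∃ h ∈ iwahoriOn ρ Q, IsAbsMinimal ρ P Q (M * (h : Matrix (l ⊕ l) (l ⊕ l) ℤ)) p q' := by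
  obtain ⟨hp, hq⟩ := hmin.mem hM
  have hq' : q' ∈ Q := by
    by_contra h
    rw [hM p q' (Or.inr h)] at hodd
    exact absurd hodd (by decide)
  obtain ⟨k, hk⟩ := exists_abs_add_two_mul_le (M p q') hmin.ne_zero
  obtain ⟨h, hh, hhM⟩ := exists_iwahoriOn_col_op hρ hQ hq hq' hne k
  have e1 := (hhM M).1 p
  refine ⟨h, hh, hmin.mul_right hh (le_antisymm (by rwa [e1]) ?_)⟩
  have := hmin.2 1 (one_mem _) h hh p q'
  rw [Submonoid.coe_one, one_mul] at this
  refine this ?_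
  rw [e1]
  exact hodd.add_even (((even_two_mul k)).mul_right _)

lemma IsAbsMinimal.exists_move_row (hρ : ∀ p, ρ p.swap = -ρ p) (hP : ∀ p ∈ P, p.swap ∈ P)
    (hM : ∀ r s, (r ∉ P ∨ s ∉ Q) → M r s = 0) (hmin : IsAbsMinimal ρ P Q M p q) {p' : l ⊕ l}
    (hodd : Odd (M p' q)) (hne : p' ≠ p) :
    ∃ g ∈ iwahoriOn ρ P, IsAbsMinimal ρ P Q ((g : Matrix (l ⊕ l) (l ⊕ l) ℤ) * M) p' q := by
  obtain ⟨h, hh, hmin'⟩ := IsAbsMinimal.exists_move_col (M := Mᵀ) (neg_order_swap hρ) hP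
    (fun r s h => hM s r h.symm) hmin.transpose hodd hne
  obtain ⟨g, hg, hgh⟩ := exists_iwahoriOn_transpose hh
  refine ⟨g, hg, ?_⟩
  have := hmin'.transpose
  rwa [neg_neg, transpose_mul, transpose_transpose, ← hgh] at this

lemma exists_isAbsMinimal (hodd : Odd (M p q)) :
    ∃ g ∈ iwahoriOn ρ P, ∃ h ∈ iwahoriOn ρ Q, ∃ p' q',
      IsAbsMinimal ρ P Q ((g : Matrix (l ⊕ l) (l ⊕ l) ℤ) * M * h) p' q' := by
  classical
  have hex : ∃ n : ℕ, ∃ g ∈ iwahoriOn ρ P, ∃ h ∈ iwahoriOn ρ Q, ∃ p' q',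
      Odd (((g : Matrix (l ⊕ l) (l ⊕ l) ℤ) * M * h) p' q') ∧
      (((g : Matrix (l ⊕ l) (l ⊕ l) ℤ) * M * h) p' q').natAbs = n :=
    ⟨_, 1, one_mem _, 1, one_mem _, p, q, by simpa using hodd, rfl⟩
  obtain ⟨g, hg, h, hh, p', q', ho, hn⟩ := Nat.find_spec hex
  refine ⟨g, hg, h, hh, p', q', ho, fun g' hg' h' hh' r s hrs => ?_⟩
  have key : (g' : Matrix (l ⊕ l) (l ⊕ l) ℤ) * (g.1 * M * h) * h' =
      ((g' * g : symplecticGroup l ℤ) : Matrix (l ⊕ l) (l ⊕ l) ℤ) * M *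
        ((h * h' : symplecticGroup l ℤ) : Matrix (l ⊕ l) (l ⊕ l) ℤ) := by
    simp only [Submonoid.coe_mul, Matrix.mul_assoc]
  rw [key] at hrs ⊢
  have := Nat.find_min' hex ⟨g' * g, mul_mem hg' hg, h * h', mul_mem hh hh', r, s, hrs, rfl⟩
  rw [← hn] at this
  rw [Int.abs_eq_natAbs, Int.abs_eq_natAbs]
  exact_mod_cast this

/-- An absolutely minimal entry that is moreover the leftmost odd entry of its row and the lowest
odd entry of its column. -/
lemma exists_isAbsMinimal_extremal (hρ : ∀ p, ρ p.swap = -ρ p) (hP : ∀ p ∈ P, p.swap ∈ P)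
    (hQ : ∀ q ∈ Q, q.swap ∈ Q) (hM : ∀ r s, (r ∉ P ∨ s ∉ Q) → M r s = 0)
    (hodd : Odd (M p q)) :
    ∃ g ∈ iwahoriOn ρ P, ∃ h ∈ iwahoriOn ρ Q, ∃ p' q',
      IsAbsMinimal ρ P Q ((g : Matrix (l ⊕ l) (l ⊕ l) ℤ) * M * h) p' q' ∧
      (∀ s, ρ s < ρ q' → Even (((g : Matrix (l ⊕ l) (l ⊕ l) ℤ) * M * h) p' s)) ∧
      (∀ r, ρ p' < ρ r → Even (((g : Matrix (l ⊕ l) (l ⊕ l) ℤ) * M * h) r q')) := by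
  obtain ⟨g₀, hg₀, h₀, hh₀, p₀, q₀, hmin₀⟩ := exists_isAbsMinimal (ρ := ρ) (P := P) (Q := Q) hodd
  obtain ⟨⟨p', q'⟩, ⟨g, hg, h, hh, hmin⟩, hext⟩ := Set.exists_min_image
    {x : (l ⊕ l) × (l ⊕ l) | ∃ g ∈ iwahoriOn ρ P, ∃ h ∈ iwahoriOn ρ Q,
      IsAbsMinimal ρ P Q ((g : Matrix (l ⊕ l) (l ⊕ l) ℤ) * M * h) x.1 x.2}
    (fun x => ρ x.2 - ρ x.1) (Set.toFinite _) ⟨(p₀, q₀), g₀, hg₀, h₀, hh₀, hmin₀⟩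
  have hM' := iwahoriOn_mul_mul_support hM hg hh
  refine ⟨g, hg, h, hh, p', q', hmin, fun s hs => ?_, fun r hr => ?_⟩
  · by_contra hcon
    obtain ⟨h', hh', hmin'⟩ := hmin.exists_move_col hρ hQ hM' (Int.not_even_iff_odd.1 hcon)
      (by rintro rfl; omega)
    have := hext (p', s) ⟨g, hg, h * h', mul_mem hh hh', by
      simpa only [Submonoid.coe_mul, Matrix.mul_assoc] using hmin'⟩
    simp only at this hs
    omega
  · by_contra hcon
    obtain ⟨g', hg', hmin'⟩ := hmin.exists_move_row hρ hP hM' (Int.not_even_iff_odd.1 hcon)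
      (by rintro rfl; omega)
    have := hext (r, q') ⟨g' * g, mul_mem hg' hg, h, hh, by
      simpa only [Submonoid.coe_mul, Matrix.mul_assoc] using hmin'⟩
    simp only at this hr
    omega

lemma exists_clear_col (hρ : ∀ p, ρ p.swap = -ρ p) (hP : ∀ p ∈ P, p.swap ∈ P) (hp : p ∈ P)
    (hM : ∀ r ∉ P, M r q = 0) (hodd : Odd (M p q)) (hdvd : ∀ r, M p q ∣ M r q)
    (heven : ∀ r, ρ p < ρ r → Even (M r q)) :
    ∃ g ∈ iwahoriOn ρ P, (∀ r ≠ p, ((g : Matrix (l ⊕ l) (l ⊕ l) ℤ) * M) r q = 0) ∧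
      ∀ s, ((g : Matrix (l ⊕ l) (l ⊕ l) ℤ) * M) p s = M p s := by
  have h0 : M p q ≠ 0 := by
    intro h
    rw [h] at hodd
    exact absurd hodd (by decide)
  choose v hv using hdvd
  have hvp : v p = 1 := mul_left_cancel₀ h0 (by rw [← hv, mul_one])
  set w : l ⊕ l → ℤ := v - Pi.single p 1 with hw
  have hwr (r : l ⊕ l) (hr : r ≠ p) : w r = v r := by simp [hw, hr]
  obtain ⟨x, hx, hxw⟩ := exists_iwahoriOn_radical hρ hP hp (w := w) (by simp [hw, hvp])
    (fun r hr => by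
      rw [hwr r (by rintro rfl; exact hr hp)]
      exact (mul_eq_zero.1 ((hv r).symm.trans (hM r hr))).resolve_left h0)
    (fun r hr => by
      rw [hwr r (by rintro rfl; omega)]
      have := heven r hr
      rw [hv r, Int.even_mul] at this
      exact even_iff_two_dvd.1 (this.resolve_left (Int.not_even_iff_odd.2 hodd)))
  have hcol (r : l ⊕ l) : (x : Matrix (l ⊕ l) (l ⊕ l) ℤ) r p = v r := by
    rw [hxw, radicalMat_apply, if_pos rfl]
    obtain rfl | hr := eq_or_ne r p
    · simp [hw]
    · simp [hw, hr]
  have hrow (s : l ⊕ l) : (x : Matrix (l ⊕ l) (l ⊕ l) ℤ) p s =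
      (1 : Matrix (l ⊕ l) (l ⊕ l) ℤ) p s := by
    have hpp : p ≠ p.swap := by cases p <;> simp
    rw [hxw, radicalMat_apply, if_neg hpp]
    simp [hw, hvp]
  have hinv : (x⁻¹ : symplecticGroup l ℤ).1 * x.1 = 1 := by
    rw [← Submonoid.coe_mul, inv_mul_cancel, Submonoid.coe_one]
  have hinv' : x.1 * (x⁻¹ : symplecticGroup l ℤ).1 = 1 := by
    rw [← Submonoid.coe_mul, mul_inv_cancel, Submonoid.coe_one]
  refine ⟨x⁻¹, inv_mem hx, fun r hr => ?_, fun s => ?_⟩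
  · have h1 : ((x⁻¹ : symplecticGroup l ℤ).1 * M) r q =
        M p q * ((x⁻¹ : symplecticGroup l ℤ).1 * x.1) r p := by
      simp_rw [Matrix.mul_apply, Finset.mul_sum, hcol]
      exact Finset.sum_congr rfl fun k _ => by rw [hv k]; ring
    rw [h1, hinv, Matrix.one_apply_ne hr, mul_zero]
  · have h2 : (x.1 * ((x⁻¹ : symplecticGroup l ℤ).1 * M)) p s =
        ((x⁻¹ : symplecticGroup l ℤ).1 * M) p s := by
      rw [Matrix.mul_apply]
      simp_rw [hrow, ← Matrix.mul_apply, one_mul]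
    rw [← h2, ← Matrix.mul_assoc, hinv', one_mul]

lemma exists_clear_row (hρ : ∀ p, ρ p.swap = -ρ p) (hQ : ∀ q ∈ Q, q.swap ∈ Q) (hq : q ∈ Q)
    (hM : ∀ s ∉ Q, M p s = 0) (hodd : Odd (M p q)) (hdvd : ∀ s, M p q ∣ M p s)
    (heven : ∀ s, ρ s < ρ q → Even (M p s)) :
    ∃ h ∈ iwahoriOn ρ Q, (∀ s ≠ q, (M * (h : Matrix (l ⊕ l) (l ⊕ l) ℤ)) p s = 0) ∧
      ∀ r, (M * (h : Matrix (l ⊕ l) (l ⊕ l) ℤ)) r q = M r q := by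
  obtain ⟨g, hg, hg1, hg2⟩ := exists_clear_col (M := Mᵀ) (neg_order_swap hρ) hQ hq hM hodd hdvd
    (fun s hs => heven s (by simpa using hs))
  obtain ⟨h, hh, hhg⟩ := exists_iwahoriOn_transpose hg
  have hMh : M * (h : Matrix (l ⊕ l) (l ⊕ l) ℤ) = (g.1 * Mᵀ)ᵀ := by simp [hhg]
  refine ⟨h, hh, ?_⟩
  rw [hMh]
  exact ⟨hg1, hg2⟩

theorem exists_iwahoriOn_pivot (hρ : ∀ p, ρ p.swap = -ρ p) (hP : ∀ p ∈ P, p.swap ∈ P)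
    (hQ : ∀ q ∈ Q, q.swap ∈ Q) (hM : ∀ r s, (r ∉ P ∨ s ∉ Q) → M r s = 0)
    (hodd : Odd (M p q)) :
    ∃ g ∈ iwahoriOn ρ P, ∃ h ∈ iwahoriOn ρ Q, ∃ p' ∈ P, ∃ q' ∈ Q,
      ∃ N : Matrix (l ⊕ l) (l ⊕ l) ℤ, N = (g : Matrix (l ⊕ l) (l ⊕ l) ℤ) * M * h ∧
      N p' q' ≠ 0 ∧ (∀ r s, N p' q' ∣ N r s) ∧ (∀ r ≠ p', N r q' = 0) ∧
      ∀ s ≠ q', N p' s = 0 := by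
  obtain ⟨g, hg, h, hh, p', q', hmin, hs, hr⟩ := exists_isAbsMinimal_extremal hρ hP hQ hM hodd
  have hM' := iwahoriOn_mul_mul_support hM hg hh
  set M' := (g : Matrix (l ⊕ l) (l ⊕ l) ℤ) * M * h with hM'def
  obtain ⟨hp', hq'⟩ := hmin.mem hM'
  have hdvd := hmin.dvd hρ hP hQ hM'
  obtain ⟨x, hx, hx1, hx2⟩ := exists_clear_col hρ hP hp' (fun r hr => hM' r q' (Or.inl hr))
    hmin.1 (fun r => hdvd r q') hr
  have hM'' := iwahoriOn_mul_mul_support hM' hx (one_mem (iwahoriOn ρ Q))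
  rw [Submonoid.coe_one, mul_one] at hM''
  obtain ⟨y, hy, hy1, hy2⟩ := exists_clear_row (M := x.1 * M') (p := p') hρ hQ hq'
    (fun s hs => hM'' p' s (Or.inr hs)) (by rw [hx2]; exact hmin.1)
    (fun s => by rw [hx2, hx2]; exact hdvd p' s) (fun s hs' => by rw [hx2]; exact hs s hs')
  have hval : (x.1 * M' * y.1) p' q' = M' p' q' := by rw [hy2, hx2]
  refine ⟨x * g, mul_mem hx hg, h * y, mul_mem hh hy, p', hp', q', hq', x.1 * M' * y.1, ?_, ?_,
    ?_, ?_, hy1⟩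
  · simp only [hM'def, Submonoid.coe_mul, Matrix.mul_assoc]
  · rw [hval]
    exact hmin.ne_zero
  · rw [hval]
    exact dvd_mul_mul_apply hdvd
  · intro r hrp
    rw [hy2, hx1 r hrp]

end

section

variable {l : Type*} [Fintype l] [DecidableEq l]

/-- The inclusion of the integral symplectic group in the rational one. -/
def symplecticCast : symplecticGroup l ℤ →* symplecticGroup l ℚ where
  toFun g := ⟨(g : Matrix (l ⊕ l) (l ⊕ l) ℤ).map (Int.castRingHom ℚ),
    SymplecticGroup.map_mem g.2 (Int.castRingHom ℚ)⟩
  map_one' := Subtype.ext (by simp)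
  map_mul' g h := Subtype.ext (Matrix.map_mul (f := Int.castRingHom ℚ))

lemma coe_symplecticCast (g : symplecticGroup l ℤ) :
    ((symplecticCast g : symplecticGroup l ℚ) : Matrix (l ⊕ l) (l ⊕ l) ℚ) =
      (g : Matrix (l ⊕ l) (l ⊕ l) ℤ).map (Int.castRingHom ℚ) := rfl

lemma symplectic_apply_swap {C : Matrix (l ⊕ l) (l ⊕ l) ℚ} (hC : C ∈ symplecticGroup l ℚ)
    {p q : l ⊕ l} (hrow : ∀ s ≠ q, C p s = 0) (r : l ⊕ l) :
    C p q * C r q.swap * sympSign q = if r = p.swap then (sympSign p : ℚ) else 0 := by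
  rw [← J_apply, ← SymplecticGroup.mem_iff.1 hC, Matrix.mul_apply,
    Finset.sum_eq_single q.swap]
  · rw [mul_J_apply, Sum.swap_swap, transpose_apply]
    ring
  · intro s _ hs
    rw [mul_J_apply, hrow s.swap (by rintro rfl; simp at hs), zero_mul, zero_mul]
  · simp

lemma symplectic_swap_row_col {C : Matrix (l ⊕ l) (l ⊕ l) ℚ} (hC : C ∈ symplecticGroup l ℚ)
    {p q : l ⊕ l} (hpq : C p q ≠ 0) (hrow : ∀ s ≠ q, C p s = 0) (hcol : ∀ r ≠ p, C r q = 0) :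
    (∀ s ≠ q.swap, C p.swap s = 0) ∧ ∀ r ≠ p.swap, C r q.swap = 0 := by
  have hsign (x : l ⊕ l) : (sympSign x : ℚ) ≠ 0 := by cases x <;> simp [sympSign]
  refine ⟨fun s hs => ?_, fun r hr => ?_⟩
  · have := symplectic_apply_swap (SymplecticGroup.transpose_mem hC) (p := q) (q := p) hcol s
    rw [if_neg hs] at this
    simpa [hsign, hpq] using this
  · have := symplectic_apply_swap hC hrow r
    rw [if_neg hr] at this
    simpa [hsign, hpq] using this

end

lemma exists_eq_mul_int_odd {ι : Type*} [Fintype ι] (f : ι → ℚ) {i₀ : ι} (h₀ : f i₀ ≠ 0) :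
    ∃ c : ℚ, c ≠ 0 ∧ ∃ g : ι → ℤ, (∀ i, f i = c * g i) ∧ ∃ i, Odd (g i) := by
  obtain ⟨b, hb⟩ := IsLocalization.exist_integer_multiples_of_finite (nonZeroDivisors ℤ) f
  choose n hn using hb
  have hb0 : ((b : ℤ) : ℚ) ≠ 0 := by exact_mod_cast nonZeroDivisors.coe_ne_zero b
  have hn' (i : ι) : (n i : ℚ) = (b : ℤ) * f i := by simpa [zsmul_eq_mul] using hn i
  obtain ⟨g, hg, hgcd⟩ := Finset.univ.extract_gcd n ⟨i₀, Finset.mem_univ _⟩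
  set d := Finset.univ.gcd n
  have hd (i : ι) : (b : ℤ) * f i = (d : ℚ) * g i := by
    rw [← hn', hg i (Finset.mem_univ _)]
    push_cast
    rfl
  refine ⟨d / (b : ℤ), div_ne_zero (fun h => ?_) hb0, g, fun i => ?_, ?_⟩
  · have := hd i₀
    rw [h, zero_mul] at this
    exact mul_ne_zero hb0 h₀ this
  · rw [div_mul_eq_mul_div, ← hd, mul_div_cancel_left₀ _ hb0]
  · by_contra! hodd
    have : (2 : ℤ) ∣ Finset.univ.gcd g := Finset.dvd_gcd fun i _ =>
      even_iff_two_dvd.1 (Int.not_odd_iff_even.1 (hodd i))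
    rw [hgcd] at this
    omega

section

variable {l : Type*} [Fintype l] [DecidableEq l] {ρ : l ⊕ l → ℤ} {P Q : Finset (l ⊕ l)}

lemma exists_iwahoriOn_rat_pivot (hρ : ∀ p, ρ p.swap = -ρ p) (hP : ∀ p ∈ P, p.swap ∈ P)
    (hQ : ∀ q ∈ Q, q.swap ∈ Q) (hne : P.Nonempty) (B : symplecticGroup l ℚ)
    (hB : ∀ r s, ¬(r ∈ P ↔ s ∈ Q) → B.1 r s = 0) :
    ∃ g ∈ iwahoriOn ρ P, ∃ h ∈ iwahoriOn ρ Q, ∃ p ∈ P, ∃ q ∈ Q, ∃ C : symplecticGroup l ℚ,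
      C = symplecticCast g * B * symplecticCast h ∧ C.1 p q ≠ 0 ∧
      (∀ r ∈ P, ∀ s, ∃ n : ℤ, C.1 r s = n * C.1 p q) ∧
      (∀ s ≠ q, C.1 p s = 0) ∧ (∀ r ≠ p, C.1 r q = 0) ∧
      ∀ r s, ¬(r ∈ P ↔ s ∈ Q) → C.1 r s = 0 := by
  obtain ⟨p₀, hp₀⟩ := hne
  obtain ⟨q₀, hpq₀⟩ : ∃ q, B.1 p₀ q ≠ 0 := by
    by_contra! h0
    have := congrFun (congrFun (congrArg Subtype.val (mul_inv_cancel B)) p₀) p₀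
    rw [Submonoid.coe_mul, Matrix.mul_apply] at this
    simp [h0] at this
  have hq₀ : q₀ ∈ Q := by
    by_contra hq
    exact hpq₀ (hB _ _ fun h => hq (h.1 hp₀))
  obtain ⟨c, hc, M, hcM, ⟨⟨p₁, q₁⟩, hodd⟩⟩ := exists_eq_mul_int_odd
    (fun x : (l ⊕ l) × (l ⊕ l) => if x.1 ∈ P ∧ x.2 ∈ Q then B.1 x.1 x.2 else 0)
    (i₀ := (p₀, q₀)) (by simpa [hp₀, hq₀] using hpq₀)
  have hM (r s : l ⊕ l) (hrs : r ∉ P ∨ s ∉ Q) : Matrix.of (fun r s => M (r, s)) r s = 0 := by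
    have := hcM (r, s)
    rw [if_neg (by tauto)] at this
    simpa [hc] using this.symm
  obtain ⟨g, hg, h, hh, p, hp, q, hq, N, hN, hpq, hdvd, hcol, hrow⟩ :=
    exists_iwahoriOn_pivot hρ hP hQ hM (p := p₁) (q := q₁) hodd
  have hNs := iwahoriOn_mul_mul_support hM hg hh
  rw [← hN] at hNs
  set B₀ : Matrix (l ⊕ l) (l ⊕ l) ℚ :=
    Matrix.of fun r s => if r ∈ P ∧ s ∈ Q then 0 else B.1 r s with hB₀
  have hB₀s (r s : l ⊕ l) (hrs : r ∈ P ∨ s ∈ Q) : B₀ r s = 0 := by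
    simp only [hB₀, Matrix.of_apply, ite_eq_left_iff]
    exact fun h' => hB r s (by tauto)
  have hsplit : B.1 = c • (Matrix.of (fun r s => M (r, s))).map (Int.castRingHom ℚ) + B₀ := by
    ext r s
    have := hcM (r, s)
    simp only [Matrix.add_apply, Matrix.smul_apply, Matrix.map_apply, Matrix.of_apply, hB₀,
      eq_intCast, smul_eq_mul, ← this]
    split_ifs <;> simp
  have hgB₀ : (symplecticCast g).1 * B₀ = B₀ := by
    ext r s
    conv_rhs => rw [← Matrix.one_mul B₀]
    rw [Matrix.mul_apply, Matrix.mul_apply]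
    refine Finset.sum_congr rfl fun k _ => ?_
    by_cases hk : k ∈ P
    · rw [hB₀s k s (Or.inl hk), mul_zero, mul_zero]
    · rw [coe_symplecticCast, Matrix.map_apply, hg.1.2 r k (Or.inr hk)]
      simp [Matrix.one_apply]
  have hB₀h : B₀ * (symplecticCast h).1 = B₀ := by
    ext r s
    conv_rhs => rw [← Matrix.mul_one B₀]
    rw [Matrix.mul_apply, Matrix.mul_apply]
    refine Finset.sum_congr rfl fun k _ => ?_
    by_cases hk : k ∈ Q
    · rw [hB₀s r k (Or.inr hk), zero_mul, zero_mul]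
    · rw [coe_symplecticCast, Matrix.map_apply, hh.1.2 k s (Or.inl hk)]
      simp [Matrix.one_apply]
  have hC : (symplecticCast g * B * symplecticCast h).1 =
      c • N.map (Int.castRingHom ℚ) + B₀ := by
    rw [Submonoid.coe_mul, Submonoid.coe_mul, hsplit, Matrix.mul_add, Matrix.add_mul, hgB₀, hB₀h,
      Matrix.mul_smul, Matrix.smul_mul, hN, Matrix.map_mul, Matrix.map_mul]
    rfl
  have hC' (r s : l ⊕ l) : (symplecticCast g * B * symplecticCast h).1 r s =
      c * N r s + B₀ r s := by rw [hC]; simp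
  refine ⟨g, hg, h, hh, p, hp, q, hq, _, rfl, ?_, fun r hr s => ?_, fun s hs => ?_, fun r hr => ?_,
    fun r s hrs => ?_⟩
  · rw [hC', hB₀s p q (Or.inl hp), add_zero]
    exact mul_ne_zero hc (by exact_mod_cast hpq)
  · obtain ⟨n, hn⟩ := hdvd r s
    refine ⟨n, ?_⟩
    rw [hC', hC', hB₀s r s (Or.inl hr), hB₀s p q (Or.inl hp), hn]
    push_cast
    ring
  · rw [hC', hB₀s p s (Or.inl hp), hrow s hs]
    simp
  · rw [hC', hB₀s r q (Or.inr hq), hcol r hr]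
    simp
  · rw [hC', hNs r s (by tauto)]
    by_cases hr : r ∈ P ∨ s ∈ Q
    · simp [hB₀s r s hr]
    · exact absurd hrs (by tauto)

end

section

variable {l : Type*} [Fintype l] [DecidableEq l] {ρ : l ⊕ l → ℤ} {P Q : Finset (l ⊕ l)}

lemma symplecticCast_mul_apply {g : symplecticGroup l ℤ} (hg : g ∈ iwahoriOn ρ P) {r : l ⊕ l}
    (hr : r ∉ P) (C : symplecticGroup l ℚ) (s : l ⊕ l) :
    (symplecticCast g * C).1 r s = C.1 r s := by
  conv_rhs => rw [← Matrix.one_mul C.1]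
  rw [Submonoid.coe_mul, Matrix.mul_apply, Matrix.mul_apply]
  refine Finset.sum_congr rfl fun k _ => ?_
  rw [coe_symplecticCast, Matrix.map_apply, hg.1.2 r k (Or.inl hr)]
  simp [Matrix.one_apply]

lemma mul_symplecticCast_apply {h : symplecticGroup l ℤ} (hh : h ∈ iwahoriOn ρ Q) {r q : l ⊕ l}
    (hq : q ∉ Q) {C : symplecticGroup l ℚ} (hrow : ∀ s ≠ q, C.1 r s = 0) (s : l ⊕ l) :
    (C * symplecticCast h).1 r s = C.1 r s := by
  conv_rhs => rw [← Matrix.mul_one C.1]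
  rw [Submonoid.coe_mul, Matrix.mul_apply, Matrix.mul_apply]
  refine Finset.sum_congr rfl fun k _ => ?_
  obtain rfl | hk := eq_or_ne k q
  · rw [coe_symplecticCast, Matrix.map_apply, hh.1.2 k s (Or.inl hq)]
    simp [Matrix.one_apply]
  · rw [hrow k hk, zero_mul, zero_mul]

lemma symplecticCast_mul_mul_int_multiple {a : ℚ} {C : symplecticGroup l ℚ}
    (hC : ∀ r ∈ P, ∀ s, ∃ n : ℤ, C.1 r s = n * a) {g : symplecticGroup l ℤ}
    (hg : g ∈ iwahoriOn ρ P) (h : symplecticGroup l ℤ) {r : l ⊕ l} (hr : r ∈ P) (s : l ⊕ l) :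
    ∃ n : ℤ, (symplecticCast g * C * symplecticCast h).1 r s = n * a := by
  choose! n hn using hC
  refine ⟨∑ j, (∑ k, g.1 r k * n k j) * h.1 j s, ?_⟩
  rw [Submonoid.coe_mul, Submonoid.coe_mul, Matrix.mul_apply, Int.cast_sum, Finset.sum_mul]
  refine Finset.sum_congr rfl fun j _ => ?_
  push_cast
  rw [Matrix.mul_apply, mul_right_comm, coe_symplecticCast h, Matrix.map_apply]
  congr 1
  rw [Finset.sum_mul]
  refine Finset.sum_congr rfl fun k _ => ?_
  rw [coe_symplecticCast, Matrix.map_apply, eq_intCast]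
  by_cases hk : k ∈ P
  · rw [hn k hk, mul_assoc]
  · rw [hg.1.2 r k (Or.inr hk), Matrix.one_apply_ne (by rintro rfl; exact hk hr)]
    simp

/-- Two rational numbers one of which is an integral multiple of the other. -/
def IntComparable (x y : ℚ) : Prop := (∃ n : ℤ, y = n * x) ∨ ∃ n : ℤ, x = n * y

lemma IntComparable.symm {x y : ℚ} (h : IntComparable x y) : IntComparable y x := Or.symm h

lemma symplectic_mul_swap {C : Matrix (l ⊕ l) (l ⊕ l) ℚ} (hC : C ∈ symplecticGroup l ℚ)
    {p q : l ⊕ l} (hrow : ∀ s ≠ q, C p s = 0) :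
    ∃ ε : ℤ, ε * ε = 1 ∧ C p q * C p.swap q.swap = ε := by
  have h := symplectic_apply_swap hC hrow p.swap
  rw [if_pos rfl] at h
  have hq : (sympSign q : ℚ) * sympSign q = 1 := by exact_mod_cast sympSign_mul_self q
  refine ⟨sympSign p * sympSign q, ?_, ?_⟩
  · rw [mul_mul_mul_comm, sympSign_mul_self, sympSign_mul_self, one_mul]
  · push_cast
    rw [← h, mul_assoc _ (sympSign q : ℚ), hq, mul_one]

lemma symplectic_swap_int_multiple {C : Matrix (l ⊕ l) (l ⊕ l) ℚ} (hC : C ∈ symplecticGroup l ℚ)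
    {p q r s : l ⊕ l} (hp : ∀ t ≠ q, C p t = 0) (hr : ∀ t ≠ s, C r t = 0)
    (hdvd : ∃ n : ℤ, C r.swap s.swap = n * C p q) :
    ∃ n : ℤ, C p.swap q.swap = n * C r s := by
  obtain ⟨n, hn⟩ := hdvd
  obtain ⟨ε, hε, h1⟩ := symplectic_mul_swap hC hp
  obtain ⟨ε', hε', h2⟩ := symplectic_mul_swap hC hr
  have hε2 : (ε' : ℚ) * ε' = 1 := by exact_mod_cast hε'
  refine ⟨ε' * ε * n, ?_⟩
  push_cast
  rw [hn] at h2
  linear_combination (-C p.swap q.swap) * hε2 - ε' * C p.swap q.swap * h2 +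
    ε' * n * C r s * h1

theorem exists_iwahoriOn_monomial (hρ : ∀ p, ρ p.swap = -ρ p) (hP : ∀ p ∈ P, p.swap ∈ P)
    (hQ : ∀ q ∈ Q, q.swap ∈ Q) (B : symplecticGroup l ℚ)
    (hB : ∀ r s, ¬(r ∈ P ↔ s ∈ Q) → B.1 r s = 0) :
    ∃ g ∈ iwahoriOn ρ P, ∃ h ∈ iwahoriOn ρ Q, ∃ C : symplecticGroup l ℚ,
      C = symplecticCast g * B * symplecticCast h ∧
      (∀ p ∈ P, ∃ q, ∀ s ≠ q, C.1 p s = 0) ∧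
      ∀ p ∈ P, ∀ r ∈ P, ∀ q s, C.1 p q ≠ 0 → C.1 r s ≠ 0 →
        IntComparable (C.1 p q) (C.1 r s) := by
  induction hn : P.card using Nat.strong_induction_on generalizing P Q B with
  | _ n ih =>
  obtain rfl | hne := P.eq_empty_or_nonempty
  · exact ⟨1, one_mem _, 1, one_mem _, _, rfl, by simp, by simp⟩
  obtain ⟨g₁, hg₁, h₁, hh₁, p, hp, q, hq, C₁, hC₁, hpq, hdvd, hrow, hcol, hblock⟩ :=
    exists_iwahoriOn_rat_pivot hρ hP hQ hne B hB
  obtain ⟨hrow', hcol'⟩ := symplectic_swap_row_col C₁.2 hpq hrow hcol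
  have herase {S : Finset (l ⊕ l)} (hS : ∀ p ∈ S, p.swap ∈ S) (x y : l ⊕ l)
      (hy : y ∈ (S.erase x).erase x.swap) : y.swap ∈ (S.erase x).erase x.swap := by
    simp only [Finset.mem_erase] at hy ⊢
    refine ⟨fun h => hy.2.1 (by simpa using congrArg Sum.swap h), fun h => hy.1 ?_, hS y hy.2.2⟩
    rw [← h, Sum.swap_swap]
  set P' := (P.erase p).erase p.swap with hP'
  set Q' := (Q.erase q).erase q.swap with hQ'
  have hPP' : P' ⊆ P := (Finset.erase_subset _ _).trans (Finset.erase_subset _ _)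
  have hQQ' : Q' ⊆ Q := (Finset.erase_subset _ _).trans (Finset.erase_subset _ _)
  have hmem (r : l ⊕ l) : r ∈ P' ↔ r ≠ p.swap ∧ r ≠ p ∧ r ∈ P := by simp [hP']
  have hmem' (r : l ⊕ l) : r ∈ Q' ↔ r ≠ q.swap ∧ r ≠ q ∧ r ∈ Q := by simp [hQ']
  have hpP' : p ∉ P' := by simp [hmem]
  have hsP' : p.swap ∉ P' := by simp [hmem]
  have hqQ' : q ∉ Q' := by simp [hmem']
  have hsQ' : q.swap ∉ Q' := by simp [hmem']
  obtain ⟨g₂, hg₂, h₂, hh₂, C, hC, hmono, hcomp⟩ := ih P'.card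
    (hn ▸ Finset.card_lt_card ⟨hPP', fun h => hpP' (h hp)⟩) (herase hP p) (herase hQ q) C₁
    (fun r s hrs => by
      by_cases hb : r ∈ P ↔ s ∈ Q
      · by_cases h1 : r = p
        · rw [h1] at hrs ⊢
          exact hrow s (by rintro rfl; tauto)
        by_cases h2 : r = p.swap
        · rw [h2] at hrs ⊢
          exact hrow' s (by rintro rfl; tauto)
        by_cases h3 : s = q
        · exact h3 ▸ hcol r h1
        by_cases h4 : s = q.swap
        · exact h4 ▸ hcol' r h2
        rw [hmem, hmem'] at hrs
        tauto
      · exact hblock r s hb) rfl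
  have hCp (s : l ⊕ l) : C.1 p s = C₁.1 p s := by
    rw [hC, mul_assoc, symplecticCast_mul_apply hg₂ hpP', mul_symplecticCast_apply hh₂ hqQ' hrow]
  have hCs (s : l ⊕ l) : C.1 p.swap s = C₁.1 p.swap s := by
    rw [hC, mul_assoc, symplecticCast_mul_apply hg₂ hsP', mul_symplecticCast_apply hh₂ hsQ' hrow']
  have hCrow (s : l ⊕ l) (hs : s ≠ q) : C.1 p s = 0 := (hCp s).trans (hrow s hs)
  have hCrow' (s : l ⊕ l) (hs : s ≠ q.swap) : C.1 p.swap s = 0 := (hCs s).trans (hrow' s hs)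
  have hCdvd (r : l ⊕ l) (hr : r ∈ P) (s : l ⊕ l) : ∃ n : ℤ, C.1 r s = n * C.1 p q := by
    rw [hCp, hC]
    exact symplecticCast_mul_mul_int_multiple hdvd (iwahoriOn_mono ρ hPP' hg₂) h₂ hr s
  have hmono' (r : l ⊕ l) (hr : r ∈ P) : ∃ s, ∀ t ≠ s, C.1 r t = 0 := by
    by_cases h1 : r = p
    · exact ⟨q, h1 ▸ hCrow⟩
    by_cases h2 : r = p.swap
    · exact ⟨q.swap, h2 ▸ hCrow'⟩
    exact hmono r ((hmem r).2 ⟨h2, h1, hr⟩)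
  have hsupp {r s t : l ⊕ l} (ht : ∀ u ≠ t, C.1 r u = 0) (hs : C.1 r s ≠ 0) : s = t := by
    by_contra h
    exact hs (ht s h)
  have hcompp (r : l ⊕ l) (hr : r ∈ P) (t s : l ⊕ l) (ht : C.1 p t ≠ 0) :
      IntComparable (C.1 p t) (C.1 r s) := by
    rw [hsupp hCrow ht]
    exact Or.inl (hCdvd r hr s)
  have hcomps (r : l ⊕ l) (hr : r ∈ P) (t s : l ⊕ l) (ht : C.1 p.swap t ≠ 0)
      (hs : C.1 r s ≠ 0) : IntComparable (C.1 p.swap t) (C.1 r s) := by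
    rw [hsupp hCrow' ht]
    obtain ⟨u, hu⟩ := hmono' r hr
    obtain rfl := hsupp hu hs
    exact Or.inr (symplectic_swap_int_multiple C.2 hCrow hu (hCdvd _ (hP r hr) _))
  refine ⟨g₂ * g₁, mul_mem (iwahoriOn_mono ρ hPP' hg₂) hg₁, h₁ * h₂,
    mul_mem hh₁ (iwahoriOn_mono ρ hQQ' hh₂), C, ?_, hmono', fun r hr t ht u s h1 h2 => ?_⟩
  · rw [hC, hC₁, map_mul, map_mul]
    simp only [mul_assoc]
  · by_cases e1 : r = p
    · subst e1
      exact hcompp t ht u s h1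
    by_cases e2 : t = p
    · subst e2
      exact (hcompp r hr s u h2).symm
    by_cases e3 : r = p.swap
    · subst e3
      exact hcomps t ht u s h1 h2
    by_cases e4 : t = p.swap
    · subst e4
      exact (hcomps r hr s u h2 h1).symm
    exact hcomp r ((hmem r).2 ⟨e3, e1, hr⟩) t ((hmem t).2 ⟨e4, e2, ht⟩) u s h1 h2

end

lemma mem_SpSet_iff {m : ℕ} {R : Type*} [CommRing R]
    {A : Matrix (Fin m ⊕ Fin m) (Fin m ⊕ Fin m) R} :
    A ∈ SpSet m R ↔ A ∈ symplecticGroup (Fin m) R := by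
  have hJ : Jmat m R = -J (Fin m) R := by
    rw [Jmat, J, fromBlocks_neg]
    simp
  change A * Jmat m R * Aᵀ = Jmat m R ↔ _
  rw [SymplecticGroup.mem_iff, hJ, mul_neg, neg_mul, neg_inj]

/-- The order of the basis vectors in which the Iwahori subgroup is upper triangular modulo `2`. -/
def iwahoriOrder (m : ℕ) : Fin m ⊕ Fin m → ℤ := Sum.elim (fun i => (i : ℤ) - m) fun i => m - (i : ℤ)

lemma iwahoriOrder_swap {m : ℕ} (p : Fin m ⊕ Fin m) :
    iwahoriOrder m p.swap = -iwahoriOrder m p := by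
  cases p <;> simp [iwahoriOrder]

lemma mem_IwahoriSet {m : ℕ} {g : symplecticGroup (Fin m) ℤ}
    (hg : g ∈ iwahoriOn (iwahoriOrder m) Finset.univ) : g.1 ∈ IwahoriSet m := by
  refine ⟨mem_SpSet_iff.2 g.2, ?_⟩
  have hcast : g.1.map (Int.cast : ℤ → ZMod 2) = g.1.map (Int.castRingHom (ZMod 2)) := rfl
  have hsymp := SymplecticGroup.map_mem g.2 (Int.castRingHom (ZMod 2))
  rw [← hcast] at hsymp
  have heven (r s : Fin m ⊕ Fin m) (hrs : iwahoriOrder m s < iwahoriOrder m r) :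
      g.1.map (Int.cast : ℤ → ZMod 2) r s = 0 :=
    (ZMod.intCast_zmod_eq_zero_iff_dvd _ 2).2 (hg.1.1 r s hrs)
  generalize g.1.map (Int.cast : ℤ → ZMod 2) = G at hsymp heven
  obtain ⟨α, γ, ζ, δ, rfl⟩ : ∃ α γ ζ δ, G = fromBlocks α γ ζ δ :=
    ⟨_, _, _, _, (fromBlocks_toBlocks G).symm⟩
  obtain rfl : ζ = 0 := by
    ext i j
    refine heven (Sum.inr i) (Sum.inl j) ?_
    simp only [iwahoriOrder, Sum.elim_inl, Sum.elim_inr]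
    omega
  obtain ⟨-, hγδ, hαδ⟩ := SymplecticGroup.fromBlocks_mem_iff.1 hsymp
  rw [transpose_zero, Matrix.zero_mul, sub_zero] at hαδ
  have hα (i j : Fin m) (hij : j < i) : α i j = 0 := heven (Sum.inl i) (Sum.inl j) (by
    simp only [iwahoriOrder, Sum.elim_inl]
    omega)
  have hδ : δ = (αᵀ)⁻¹ := (Matrix.inv_eq_right_inv hαδ).symm
  have hδα : δᵀ * α = 1 := by simpa using congrArg transpose hαδ
  have hdiag : ∏ i, α i i ≠ 0 := by
    rw [← Matrix.det_of_isUpperTriangular (M := α) (fun i j hij => hα i j hij)]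
    intro h
    have := congrArg Matrix.det hδα
    rw [Matrix.det_mul, h, mul_zero, Matrix.det_one] at this
    exact zero_ne_one this
  refine ⟨α, δᵀ * γ, hα, fun i => ?_, ?_, ?_⟩
  · exact Fin.eq_one_of_ne_zero _ (Finset.prod_ne_zero_iff.1 hdiag i (Finset.mem_univ i))
  · rw [transpose_mul, transpose_transpose, hγδ]
  · rw [← Matrix.mul_assoc, mul_eq_one_comm.1 hδα, Matrix.one_mul, hδ]

lemma diagonal_mem_symplecticGroup {l : Type*} [Fintype l] [DecidableEq l] {E : l ⊕ l → ℤ}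
    (hE : ∀ p, E p * E p.swap = 1) : Matrix.diagonal E ∈ symplecticGroup l ℤ := by
  rw [SymplecticGroup.mem_iff]
  ext p q
  rw [diagonal_transpose, Matrix.mul_diagonal, Matrix.diagonal_mul, J_apply]
  split_ifs with h
  · rw [h, mul_right_comm, hE, one_mul]
  · simp

lemma exists_iwahoriOn_diagonal {l : Type*} [Fintype l] [DecidableEq l] (ρ : l ⊕ l → ℤ)
    {E : l ⊕ l → ℤ} (hE : ∀ p, E p * E p.swap = 1) :
    ∃ g ∈ iwahoriOn ρ Finset.univ, (g : Matrix (l ⊕ l) (l ⊕ l) ℤ) = Matrix.diagonal E := by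
  have hdiag (F : l ⊕ l → ℤ) : IsIwahoriOn ρ Finset.univ (Matrix.diagonal F) :=
    ⟨fun r s h => by rw [Matrix.diagonal_apply_ne _ (by rintro rfl; omega)]; simp, by simp⟩
  have hE' (p : l ⊕ l) : E p.swap * E p.swap.swap = 1 := hE _
  let g : symplecticGroup l ℤ := ⟨_, diagonal_mem_symplecticGroup hE⟩
  let h : symplecticGroup l ℤ := ⟨_, diagonal_mem_symplecticGroup hE'⟩
  have hgh : g⁻¹ = h := inv_eq_of_mul_eq_one_right (Subtype.ext (by
    change Matrix.diagonal E * Matrix.diagonal (fun p => E p.swap) = 1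
    rw [Matrix.diagonal_mul_diagonal, ← Matrix.diagonal_one]
    exact congrArg _ (funext hE)))
  exact ⟨g, ⟨hdiag E, hgh ▸ hdiag _⟩, rfl⟩

lemma eq_or_eq_swap_of_elim_id_eq {l : Type*} {a b : l ⊕ l}
    (h : Sum.elim id id a = Sum.elim id id b) : a = b ∨ a = b.swap := by
  cases a <;> cases b <;> simpa using h

lemma permWeyl_mul_signWeyl_apply {m : ℕ} (s : Equiv.Perm (Fin m)) (S : Finset (Fin m))
    (p q : Fin m ⊕ Fin m) :
    (permWeyl m ℚ s * signWeyl m ℚ S) p q = signWeyl m ℚ S (Sum.map s s p) q := by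
  rw [Matrix.mul_apply, Fintype.sum_sum_type]
  cases p <;> simp [permWeyl]

lemma exists_mem_WeylSet {m : ℕ} {f : Fin m ⊕ Fin m → Fin m ⊕ Fin m}
    (hf : Function.Injective f) (hswap : ∀ p, f p.swap = (f p).swap) :
    ∃ w ∈ WeylSet m ℚ, ∃ ε : Fin m ⊕ Fin m → ℤ, (∀ p, ε p * ε p = 1) ∧
      (∀ p, ε p * ε p.swap = sympSign p * sympSign (f p)) ∧
      ∀ p q, w p q = if q = f p then (ε p : ℚ) else 0 := by
  classical
  have hinj : Function.Injective fun i => Sum.elim id id (f (Sum.inl i)) := by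
    intro i j hij
    rcases eq_or_eq_swap_of_elim_id_eq hij with h | h
    · exact Sum.inl_injective (hf h)
    · rw [← hswap] at h
      exact absurd (hf h) (by simp)
  let s : Equiv.Perm (Fin m) := Equiv.ofBijective _ (Finite.injective_iff_bijective.1 hinj)
  have hs (i : Fin m) : s i = Sum.elim id id (f (Sum.inl i)) := rfl
  let S : Finset (Fin m) := Finset.univ.filter fun j => ∃ i, f (Sum.inl i) = Sum.inr j
  have hS (i : Fin m) : s i ∈ S ↔ f (Sum.inl i) = Sum.inr (s i) := by
    simp only [S, Finset.mem_filter, Finset.mem_univ, true_and]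
    refine ⟨fun ⟨k, hk⟩ => ?_, fun h => ⟨i, h⟩⟩
    obtain rfl : k = i := s.injective (by rw [hs, hk]; rfl)
    exact hk
  have hfl (i : Fin m) :
      f (Sum.inl i) = if s i ∈ S then Sum.inr (s i) else Sum.inl (s i) := by
    split_ifs with h
    · exact (hS i).1 h
    · rw [hS, hs] at h
      rw [hs]
      generalize f (Sum.inl i) = a at h
      cases a
      · rfl
      · exact absurd rfl h
  have hfr (i : Fin m) :
      f (Sum.inr i) = if s i ∈ S then Sum.inl (s i) else Sum.inr (s i) := by
    rw [← Sum.swap_inl, hswap, hfl]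
    split_ifs <;> rfl
  refine ⟨_, ⟨s, S, rfl⟩, Sum.elim (fun i => if s i ∈ S then -1 else 1) fun _ => 1, ?_, ?_, ?_⟩
  · rintro (i | i)
    · simp only [Sum.elim_inl]
      split_ifs <;> simp
    · simp
  · rintro (i | i)
    · simp only [Sum.swap_inl, Sum.elim_inl, Sum.elim_inr, hfl]
      split_ifs <;> simp [sympSign]
    · simp only [Sum.swap_inr, Sum.elim_inl, Sum.elim_inr, hfr]
      split_ifs <;> simp [sympSign]
  · rintro (i | i) (j | j) <;> rw [permWeyl_mul_signWeyl_apply] <;>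
      simp only [signWeyl, Matrix.of_apply, Sum.map_inl, Sum.map_inr, hfl, hfr] <;>
      by_cases h : s i ∈ S <;> simp [h, eq_comm]

lemma IntComparable.exists_int_abs_eq {x y : ℚ} (h : IntComparable x y) {ε : ℤ}
    (hε : ε * ε = 1) (hxy : x * y = ε) :
    ∃ n : ℤ, 0 < n ∧ (|x| = n ∨ |y| = n) := by
  wlog hle : ∃ n : ℤ, y = n * x generalizing x y
  · obtain ⟨n, hn, h'⟩ := this h.symm (by rw [mul_comm, hxy]) (h.resolve_left hle)
    exact ⟨n, hn, h'.symm⟩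
  obtain ⟨n, hn⟩ := hle
  have hy : y ^ 2 = algebraMap ℤ ℚ (n * ε) := by
    rw [eq_intCast]
    push_cast
    rw [← hxy]
    nth_rewrite 1 [sq, hn]
    ring
  obtain ⟨k, hk⟩ := IsIntegrallyClosed.exists_algebraMap_eq_of_isIntegral_pow two_pos
    (hy ▸ isIntegral_algebraMap : IsIntegral ℤ (y ^ 2))
  have hy0 : y ≠ 0 := by
    rintro rfl
    rw [mul_zero] at hxy
    have : ε = 0 := by exact_mod_cast hxy.symm
    rw [this] at hε
    exact absurd hε (by decide)
  rw [eq_intCast] at hk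
  refine ⟨|k|, abs_pos.2 fun h0 => hy0 ?_, Or.inr ?_⟩
  · rw [← hk, h0, Int.cast_zero]
  · rw [← hk, Int.cast_abs]

lemma IntComparable.dvd_of_abs_eq {x y : ℚ} (h : IntComparable x y) {a b : ℤ} (hx : |x| = a)
    (hy : |y| = b) : a ∣ b ∨ b ∣ a := by
  refine h.imp (fun ⟨n, hn⟩ => ⟨|n|, ?_⟩) fun ⟨n, hn⟩ => ⟨|n|, ?_⟩
  · rw [hn, abs_mul, hx] at hy
    rw [mul_comm]
    exact_mod_cast hy.symm
  · rw [hn, abs_mul, hy] at hx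
    rw [mul_comm]
    exact_mod_cast hx.symm

section

variable {l : Type*} [Fintype l] [DecidableEq l]

lemma symplectic_monomial {C : symplecticGroup l ℚ} {f : l ⊕ l → l ⊕ l}
    (hf : ∀ p, ∀ s ≠ f p, C.1 p s = 0) :
    Function.Injective f ∧ (∀ p, f p.swap = (f p).swap) ∧
      ∀ p, C.1 p (f p) * C.1 p.swap (f p.swap) = (sympSign p * sympSign (f p) : ℤ) := by
  have hsq (x : l ⊕ l) : (sympSign x : ℚ) * sympSign x = 1 := by
    exact_mod_cast sympSign_mul_self x
  have hmul (p : l ⊕ l) := symplectic_apply_swap C.2 (hf p)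
  have hne (p : l ⊕ l) : C.1 p (f p) * C.1 p.swap (f p).swap ≠ 0 := by
    intro h
    have h1 := hmul p p.swap
    rw [h, zero_mul, if_pos rfl] at h1
    have h2 := hsq p
    rw [← h1, zero_mul] at h2
    exact zero_ne_one h2
  have hswap (p : l ⊕ l) : f p.swap = (f p).swap := by
    by_contra h
    exact hne p (by rw [hf p.swap _ (Ne.symm h), mul_zero])
  refine ⟨fun p r hpr => ?_, hswap, fun p => ?_⟩
  · by_contra h
    have h1 := hmul p.swap r
    rw [hswap, Sum.swap_swap, Sum.swap_swap, if_neg (Ne.symm h), ← hswap, hpr] at h1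
    have h2 := hsq (f p.swap)
    have h3 := left_ne_zero_of_mul (hne p.swap)
    have h4 := left_ne_zero_of_mul (hne r)
    have h5 : (sympSign (f p.swap) : ℚ) ≠ 0 := left_ne_zero_of_mul (h2 ▸ one_ne_zero)
    exact mul_ne_zero (mul_ne_zero h3 h4) h5 h1
  · have h1 := hmul p p.swap
    rw [if_pos rfl] at h1
    rw [hswap]
    push_cast
    rw [← h1, mul_assoc _ (sympSign (f p) : ℚ), hsq, mul_one]

end

lemma exists_weyl_decomposition {m : ℕ} (C : symplecticGroup (Fin m) ℚ)
    (hmono : ∀ p, ∃ q, ∀ s ≠ q, C.1 p s = 0)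
    (hcomp : ∀ p r q s, C.1 p q ≠ 0 → C.1 r s ≠ 0 → IntComparable (C.1 p q) (C.1 r s)) :
    ∃ E : Fin m ⊕ Fin m → ℤ, (∀ p, E p * E p.swap = 1) ∧
      ∃ w₁ ∈ WeylSet m ℚ, ∃ w₂ ∈ WeylSet m ℚ, ∃ d ∈ D0Set m,
        C.1 = (Matrix.diagonal E).map (Int.castRingHom ℚ) * w₁ * d * w₂ := by
  choose f hf using hmono
  obtain ⟨hinj, hswap, hmul⟩ := symplectic_monomial hf
  set c : Fin m ⊕ Fin m → ℚ := fun p => C.1 p (f p)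
  have hsign (p : Fin m ⊕ Fin m) :
      sympSign p * sympSign (f p) * (sympSign p * sympSign (f p)) = 1 := by
    rw [mul_mul_mul_comm, sympSign_mul_self, sympSign_mul_self, one_mul]
  have hc0 (p : Fin m ⊕ Fin m) : c p ≠ 0 := by
    refine left_ne_zero_of_mul (b := c p.swap) ?_
    rw [hmul]
    exact_mod_cast left_ne_zero_of_mul ((hsign p).symm ▸ one_ne_zero)
  have habs_mul (p : Fin m ⊕ Fin m) : |c p| * |c p.swap| = 1 := by
    rw [← abs_mul, hmul]
    cases p <;> cases f _ <;> simp [sympSign]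
  have hcompc (p r : Fin m ⊕ Fin m) : IntComparable (c p) (c r) :=
    hcomp p r _ _ (hc0 p) (hc0 r)
  have hex (i : Fin m) : ∃ x : Fin m ⊕ Fin m, ∃ n : ℤ,
      Sum.elim id id x = i ∧ 0 < n ∧ |c x| = n := by
    obtain ⟨n, hn, h | h⟩ :=
      (hcompc (Sum.inl i) (Sum.inl i).swap).exists_int_abs_eq (hsign (Sum.inl i)) (hmul _)
    · exact ⟨_, n, rfl, hn, h⟩
    · exact ⟨_, n, rfl, hn, h⟩
  choose e δ he hδ habs using hex
  let τ : Equiv.Perm (Fin m) := Tuple.sort fun i => -δ i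
  have hτ (i j : Fin m) (hij : i ≤ j) : δ (τ j) ∣ δ (τ i) := by
    have hle : δ (τ j) ≤ δ (τ i) := by simpa using Tuple.monotone_sort (fun i => -δ i) hij
    rcases (hcompc (e (τ j)) (e (τ i))).dvd_of_abs_eq (habs _) (habs _) with h | h
    · exact h
    · exact (hle.antisymm (Int.le_of_dvd (hδ _) h)) ▸ dvd_rfl
  let u : Fin m ⊕ Fin m → Fin m ⊕ Fin m :=
    Sum.elim (fun k => e (τ k)) fun k => (e (τ k)).swap
  have hu_swap (p : Fin m ⊕ Fin m) : u p.swap = (u p).swap := by cases p <;> simp [u]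
  have hne_swap (p : Fin m ⊕ Fin m) : p ≠ p.swap := by cases p <;> simp
  have hu_proj (p : Fin m ⊕ Fin m) : Sum.elim id id (u p) = τ (Sum.elim id id p) := by
    have h (x : Fin m ⊕ Fin m) : Sum.elim id id x.swap = Sum.elim id id x := by cases x <;> rfl
    cases p <;> simp only [u, Sum.elim_inl, Sum.elim_inr, h, he, id]
  have hu : Function.Injective u := by
    intro a b hab
    have h1 := congrArg (Sum.elim id id) hab
    rw [hu_proj, hu_proj] at h1
    refine (eq_or_eq_swap_of_elim_id_eq (τ.injective h1)).resolve_right ?_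
    rintro rfl
    exact hne_swap (u b) (by rw [← hu_swap, hab])
  let U : Equiv.Perm (Fin m ⊕ Fin m) := Equiv.ofBijective u (Finite.injective_iff_bijective.1 hu)
  have hU_swap (p : Fin m ⊕ Fin m) : U.symm p.swap = (U.symm p).swap := by
    rw [Equiv.symm_apply_eq]
    change _ = u _
    rw [hu_swap]
    exact congrArg Sum.swap (U.apply_symm_apply p).symm
  let D : Fin m ⊕ Fin m → ℚ := Sum.elim (fun i => (δ (τ i) : ℚ)) fun i => (δ (τ i) : ℚ)⁻¹
  have hD (k : Fin m ⊕ Fin m) : |c (u k)| = D k := by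
    cases k with
    | inl k => exact habs _
    | inr k =>
      refine eq_inv_of_mul_eq_one_right ?_
      rw [← habs]
      exact habs_mul _
  have hD' (p : Fin m ⊕ Fin m) : |c p| = D (U.symm p) := by
    rw [← hD]
    exact congrArg _ (congrArg c (U.apply_symm_apply p).symm)
  obtain ⟨w₁, hw₁, ε₁, hε₁, hε₁', hw₁'⟩ := exists_mem_WeylSet U.symm.injective hU_swap
  obtain ⟨w₂, hw₂, ε₂, hε₂, hε₂', hw₂'⟩ := exists_mem_WeylSet (hinj.comp hu)
    (fun p => by simp only [Function.comp_apply, hu_swap, hswap])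
  let η : Fin m ⊕ Fin m → ℤ := fun p => if 0 < c p then 1 else -1
  have hη (p : Fin m ⊕ Fin m) : c p = η p * |c p| := by
    simp only [η]
    split_ifs with h
    · simp [abs_of_pos h]
    · simp [abs_of_nonpos (not_lt.1 h)]
  have hη' (p : Fin m ⊕ Fin m) : η p * η p.swap = sympSign p * sympSign (f p) := by
    have h := hmul p
    change c p * c p.swap = _ at h
    rw [hη p, hη p.swap, mul_mul_mul_comm, habs_mul, mul_one] at h
    exact_mod_cast h
  have hfu (p : Fin m ⊕ Fin m) : (f ∘ u) (U.symm p) = f p :=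
    congrArg f (U.apply_symm_apply p)
  refine ⟨fun p => η p * ε₁ p * ε₂ (U.symm p), fun p => ?_, w₁, hw₁, w₂, hw₂, _,
    ⟨fun i => δ (τ i), fun i => hδ _, hτ, rfl⟩, ?_⟩
  · have h1 := hε₂' (U.symm p)
    rw [hfu] at h1
    simp only [hU_swap]
    calc _ = η p * η p.swap * (ε₁ p * ε₁ p.swap) * (ε₂ (U.symm p) * ε₂ (U.symm p).swap) := by ring
      _ = sympSign p * sympSign p * (sympSign (U.symm p) * sympSign (U.symm p)) *
          (sympSign (f p) * sympSign (f p)) := by rw [hη', hε₁', h1]; ring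
      _ = 1 := by simp only [sympSign_mul_self, one_mul]
  · ext p q
    rw [Matrix.diagonal_map (map_zero _), Matrix.mul_assoc, Matrix.mul_assoc, Matrix.diagonal_mul,
      ← Matrix.mul_assoc, Matrix.mul_apply, Finset.sum_eq_single (U.symm p)]
    · rw [Matrix.mul_diagonal, hw₁', if_pos rfl, hw₂', hfu]
      split_ifs with h
      · rw [h]
        change c p = _ * (_ * D _ * _)
        rw [hη p, hD']
        have h1 : (ε₁ p : ℚ) * ε₁ p = 1 := by exact_mod_cast hε₁ p
        have h2 : (ε₂ (U.symm p) : ℚ) * ε₂ (U.symm p) = 1 := by exact_mod_cast hε₂ _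
        rw [eq_intCast]
        push_cast
        linear_combination (-η p * D (U.symm p)) * h1 -
          η p * D (U.symm p) * ε₁ p * ε₁ p * h2
      · rw [hf p q h, mul_zero, mul_zero]
    · intro k _ hk
      rw [Matrix.mul_diagonal, hw₁', if_neg hk, zero_mul, zero_mul]
    · simp

/-- Iwahori decomposition of `Sp_{2m}(ℚ)` at the prime 2:
every `A ∈ Sp_{2m}(ℚ)` is of the form `i₁ ω₁ d ω₂ i₂` with `i₁, i₂ ∈ I`,
`ω₁, ω₂ ∈ 𝔚` and `d ∈ D₀`. -/
theorem stmt_0 (m : ℕ) (hm : 1 ≤ m)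
    (A : Matrix (Fin m ⊕ Fin m) (Fin m ⊕ Fin m) ℚ) (hA : A ∈ SpSet m ℚ) :
    ∃ i₁ ∈ IwahoriSet m, ∃ i₂ ∈ IwahoriSet m,
      ∃ w₁ ∈ WeylSet m ℚ, ∃ w₂ ∈ WeylSet m ℚ, ∃ d ∈ D0Set m,
        A = castQ m i₁ * w₁ * d * w₂ * castQ m i₂ := by
  obtain ⟨g, hg, h, hh, C, hC, hmono, hcomp⟩ := exists_iwahoriOn_monomial
    (P := Finset.univ) (Q := Finset.univ) (iwahoriOrder_swap (m := m)) (by simp) (by simp)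
    ⟨A, mem_SpSet_iff.1 hA⟩ (by simp)
  obtain ⟨E, hE, w₁, hw₁, w₂, hw₂, d, hd, hCE⟩ := exists_weyl_decomposition C
    (fun p => hmono p (Finset.mem_univ p))
    fun p r => hcomp p (Finset.mem_univ p) r (Finset.mem_univ r)
  obtain ⟨x, hx, hxE⟩ := exists_iwahoriOn_diagonal (iwahoriOrder m) hE
  refine ⟨_, mem_IwahoriSet (mul_mem (inv_mem hg) hx), _, mem_IwahoriSet (inv_mem hh), w₁, hw₁,
    w₂, hw₂, d, hd, ?_⟩
  have hA' : (⟨A, mem_SpSet_iff.1 hA⟩ : symplecticGroup (Fin m) ℚ) =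
      symplecticCast g⁻¹ * C * symplecticCast h⁻¹ := by
    rw [hC, map_inv, map_inv]
    group
  have hcast (y : symplecticGroup (Fin m) ℤ) : castQ m y.1 = (symplecticCast y).1 := rfl
  rw [hcast, hcast, map_mul, Submonoid.coe_mul, coe_symplecticCast x, hxE]
  have := congrArg Subtype.val hA'
  rw [Submonoid.coe_mul, Submonoid.coe_mul, hCE] at this
  simpa only [Matrix.mul_assoc] using this
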